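/- arXiv:2311.10020 — 9 statements merged into one kernel-verified Lean document; each statement's English description precedes it below -/
import Mathlib

section
/- Consider the planar piecewise discontinuous differential system given by (ẋ, ẏ) = (y, −(V⁺)′(x)) for y ≥ 0 and (ẋ, ẏ) = ((V⁻)′(y), −x) for y < 0, where V⁺ and V⁻ are real-analytic near 0 with V⁺(0) = V⁻(0) = 0, (V⁺)′(0) = 0, (V⁺)″(0) > 0 and (V⁻)′(0) < 0. Then the period function T(x) = T⁺(x) + T⁻(x) is non-constant on (0, ε) for every sufficiently small ε > 0; that is, the non-smooth center at the origin is not isochronous. -/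
open Real Filter Set Topology MeasureTheory intervalIntegral

/-- Change of variables along an increasing map whose derivative may vanish, and whose
transported integrand may blow up, at the endpoints. -/
lemma intervalIntegral_eq_of_increasing_change {a b : ℝ} (hab : a < b) {φ φ' F G : ℝ → ℝ}
    (hφ : ContinuousOn φ (Icc a b)) (hφ' : ∀ θ ∈ Ioo a b, HasDerivAt φ (φ' θ) θ)
    (hpos : ∀ θ ∈ Ioo a b, 0 < φ' θ) (hG : ContinuousOn G (Icc a b))
    (hFG : ∀ θ ∈ Ioo a b, φ' θ * F (φ θ) = G θ) :
    IntervalIntegrable F volume (φ a) (φ b) ∧ ∫ s in φ a..φ b, F s = ∫ θ in a..b, G θ := by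
  have hmono : StrictMonoOn φ (Icc a b) := by
    refine strictMonoOn_of_deriv_pos (convex_Icc a b) hφ fun θ hθ => ?_
    rw [interior_Icc] at hθ
    rw [(hφ' θ hθ).deriv]
    exact hpos θ hθ
  have hle : φ a ≤ φ b :=
    (hmono (left_mem_Icc.2 hab.le) (right_mem_Icc.2 hab.le) hab).le
  have himage : φ '' Ioo a b = Ioo (φ a) (φ b) := by
    refine Subset.antisymm ?_ (intermediate_value_Ioo hab.le hφ)
    rintro _ ⟨θ, hθ, rfl⟩
    exact ⟨hmono (left_mem_Icc.2 hab.le) (Ioo_subset_Icc_self hθ) hθ.1,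
      hmono (Ioo_subset_Icc_self hθ) (right_mem_Icc.2 hab.le) hθ.2⟩
  have hinj : InjOn φ (Ioo a b) := hmono.injOn.mono Ioo_subset_Icc_self
  have hderiv : ∀ θ ∈ Ioo a b, HasDerivWithinAt φ (φ' θ) (Ioo a b) θ :=
    fun θ hθ => (hφ' θ hθ).hasDerivWithinAt
  have hcongr : EqOn (fun θ => |φ' θ| • F (φ θ)) G (Ioo a b) := fun θ hθ => by
    simp only [smul_eq_mul, abs_of_pos (hpos θ hθ), hFG θ hθ]
  constructor
  · rw [intervalIntegrable_iff_integrableOn_Ioo_of_le hle, ← himage,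
      integrableOn_image_iff_integrableOn_abs_deriv_smul measurableSet_Ioo hderiv hinj,
      integrableOn_congr_fun hcongr measurableSet_Ioo]
    exact hG.integrableOn_Icc.mono_set Ioo_subset_Icc_self
  · rw [integral_of_le hle, integral_of_le hab.le, integral_Ioc_eq_integral_Ioo,
      integral_Ioc_eq_integral_Ioo, ← himage,
      integral_image_eq_integral_abs_deriv_smul measurableSet_Ioo hderiv hinj]
    exact setIntegral_congr_fun measurableSet_Ioo hcongr

lemma AnalyticAt.exists_eq_id_mul {f : ℝ → ℝ} (hf : AnalyticAt ℝ f 0) (h0 : f 0 = 0) :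
    ∃ q : ℝ → ℝ, AnalyticAt ℝ q 0 ∧ ∀ᶠ s in 𝓝 0, f s = s * q s := by
  have h : ((1 : ℕ) : ℕ∞) ≤ analyticOrderAt f 0 := by
    rw [Nat.cast_one, Order.one_le_iff_ne_zero]
    exact hf.analyticOrderAt_ne_zero.2 h0
  simpa using (natCast_le_analyticOrderAt hf).1 h

lemma AnalyticAt.deriv_id_mul {q : ℝ → ℝ} {s : ℝ} (hq : AnalyticAt ℝ q s) :
    deriv (fun s => s * q s) s = q s + s * deriv q s := by
  rw [deriv_fun_mul differentiableAt_fun_id hq.differentiableAt, deriv_id'', one_mul]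

lemma AnalyticAt.exists_right_inverse {u : ℝ → ℝ} (hu : AnalyticAt ℝ u 0) (h0 : u 0 = 0)
    (h1 : 0 < deriv u 0) :
    ∃ g : ℝ → ℝ, AnalyticAt ℝ g 0 ∧ g 0 = 0 ∧ 0 < deriv g 0 ∧ ∀ᶠ t in 𝓝 0, u (g t) = t := by
  have hs := hu.hasStrictDerivAt
  refine ⟨hs.localInverse _ _ _ h1.ne', ?_, ?_, ?_, ?_⟩
  · simpa only [h0] using hu.analyticAt_localInverse h1.ne'
  · have := HasStrictFDerivAt.localInverse_apply_image (hs.hasStrictFDerivAt_equiv h1.ne')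
    rwa [h0] at this
  · have := hs.to_localInverse h1.ne'
    rw [h0] at this
    rw [this.hasDerivAt.deriv]
    positivity
  · have := hs.eventually_right_inverse h1.ne'
    rwa [h0] at this

/-- An analytic function with a nondegenerate minimum `0` at `0` becomes `t² / 2` in a suitable
increasing analytic coordinate. -/
lemma AnalyticAt.exists_morse_coordinate {V : ℝ → ℝ} (hV : AnalyticAt ℝ V 0) (h0 : V 0 = 0)
    (h1 : deriv V 0 = 0) (h2 : 0 < iteratedDeriv 2 V 0) :
    ∃ g : ℝ → ℝ, AnalyticAt ℝ g 0 ∧ g 0 = 0 ∧ 0 < deriv g 0 ∧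
      ∀ᶠ t in 𝓝 0, V (g t) = t ^ 2 / 2 := by
  obtain ⟨p, hp, hVp⟩ := hV.exists_eq_id_mul h0
  have hderiv : ∀ᶠ s in 𝓝 (0 : ℝ), deriv V s = p s + s * deriv p s := by
    filter_upwards [hVp.eventually_nhds, hp.eventually_analyticAt] with s hs hps
    rw [EventuallyEq.deriv_eq hs, hps.deriv_id_mul]
  have hp0 : p 0 = 0 := by simpa [h1] using hderiv.self_of_nhds.symm
  obtain ⟨q, hq, hpq⟩ := hp.exists_eq_id_mul hp0
  have hp' : deriv p 0 = q 0 := by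
    rw [EventuallyEq.deriv_eq hpq, hq.deriv_id_mul, zero_mul, add_zero]
  have hq0 : 0 < q 0 := by
    have : iteratedDeriv 2 V 0 = 2 * q 0 := by
      rw [iteratedDeriv_succ, iteratedDeriv_one, EventuallyEq.deriv_eq hderiv]
      rw [deriv_fun_add hp.differentiableAt
          (differentiableAt_fun_id.fun_mul hp.deriv.differentiableAt),
        hp.deriv.deriv_id_mul, hp', zero_mul, add_zero, two_mul]
    linarith
  have hsqrt : AnalyticAt ℝ (fun s => √(2 * q s)) 0 :=
    (ContDiffAt.sqrt (n := ⊤) (contDiffAt_const.mul hq.contDiffAt) (by positivity)).analyticAt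
  have hu : AnalyticAt ℝ (fun s => s * √(2 * q s)) 0 := analyticAt_id.mul hsqrt
  have hu1 : deriv (fun s => s * √(2 * q s)) 0 = √(2 * q 0) := by
    rw [hsqrt.deriv_id_mul, zero_mul, add_zero]
  obtain ⟨g, hg, hg0, hg1, hgu⟩ :=
    hu.exists_right_inverse (by simp) (by rw [hu1]; positivity)
  refine ⟨g, hg, hg0, hg1, ?_⟩
  have hlim : Tendsto g (𝓝 0) (𝓝 0) := by
    simpa only [hg0] using hg.continuousAt.tendsto
  filter_upwards [hgu, hlim.eventually hVp, hlim.eventually hpq,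
    hlim.eventually (hq.continuousAt.eventually_const_lt hq0)] with t ht hVt hpt hqt
  rw [hVt, hpt, ← ht, mul_pow, sq_sqrt (by positivity), ht]
  ring

/-- Uniform control of an analytic function with positive derivative on a small interval. -/
lemma AnalyticAt.exists_bounds_of_deriv_pos {g : ℝ → ℝ} (hg : AnalyticAt ℝ g 0)
    (h1 : 0 < deriv g 0) {P : ℝ → Prop} (hP : ∀ᶠ t in 𝓝 0, P t) :
    ∃ δ > 0, ∀ t ∈ Icc (-δ) δ,
      AnalyticAt ℝ g t ∧ deriv g 0 / 2 ≤ deriv g t ∧ deriv g t ≤ deriv g 0 + 1 ∧ P t := by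
  have hc := hg.deriv.continuousAt
  have hev := hg.eventually_analyticAt.and
    ((hc.eventually_const_le (half_lt_self h1)).and
      ((hc.eventually_le_const (lt_add_one _)).and hP))
  obtain ⟨δ, hδ, h⟩ := Metric.nhds_basis_closedBall.eventually_iff.1 hev
  refine ⟨δ, hδ, fun t ht => h ?_⟩
  rwa [Real.closedBall_eq_Icc, zero_sub, zero_add]

/-- The largest negative solution of `f s = A` is unique. -/
lemma eq_of_largest_negative_solution {f : ℝ → ℝ} {A p q : ℝ} (hp0 : p < 0) (hp : f p = A)
    (hp' : ∀ s ∈ Ioo p 0, f s ≠ A) (hq0 : q < 0) (hq : f q = A)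
    (hq' : ∀ s ∈ Ioo q 0, f s ≠ A) : p = q := by
  rcases lt_trichotomy p q with h | h | h
  · exact absurd hq (hp' q ⟨h, hq0⟩)
  · exact h
  · exact absurd hp (hq' p ⟨h, hp0⟩)

lemma strictMonoOn_of_analyticAt_deriv_pos {g : ℝ → ℝ} {m a b : ℝ} (hm : 0 < m)
    (h : ∀ t ∈ Icc a b, AnalyticAt ℝ g t ∧ m ≤ deriv g t) :
    StrictMonoOn g (Icc a b) :=
  strictMonoOn_of_deriv_pos (convex_Icc a b)
    (fun t ht => (h t ht).1.continuousAt.continuousWithinAt)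
    fun t ht => hm.trans_le (h t (interior_subset ht)).2

/-- Upper half-plane time in the coordinate in which the potential is `t² / 2`. -/
lemma upper_time_eq {V g : ℝ → ℝ} {h : ℝ} (hh : 0 < h)
    (hg : ∀ t ∈ Icc (-h) h, AnalyticAt ℝ g t ∧ 0 < deriv g t ∧ V (g t) = t ^ 2 / 2) :
    IntervalIntegrable (fun s => 1 / √(2 * (V (g h) - V s))) volume (g (-h)) (g h) ∧
      ∫ s in g (-h)..g h, 1 / √(2 * (V (g h) - V s)) =
        ∫ θ in (-(π / 2))..(π / 2), deriv g (h * sin θ) := by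
  have hmem : ∀ θ, h * sin θ ∈ Icc (-h) h := fun θ =>
    ⟨by nlinarith [neg_one_le_sin θ], by nlinarith [sin_le_one θ]⟩
  have hsin : ∀ θ : ℝ, HasDerivAt (fun θ => h * sin θ) (h * cos θ) θ :=
    fun θ => (hasDerivAt_sin θ).const_mul h
  have hφ : ∀ θ : ℝ,
      HasDerivAt (fun θ => g (h * sin θ)) (deriv g (h * sin θ) * (h * cos θ)) θ := fun θ =>
    (hg _ (hmem θ)).1.differentiableAt.hasDerivAt.comp θ (hsin θ)
  have key := intervalIntegral_eq_of_increasing_change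
    (a := -(π / 2)) (b := π / 2) (by linarith [pi_pos])
    (φ := fun θ => g (h * sin θ)) (φ' := fun θ => deriv g (h * sin θ) * (h * cos θ))
    (F := fun s => 1 / √(2 * (V (g h) - V s))) (G := fun θ => deriv g (h * sin θ))
    (fun θ _ => (hφ θ).continuousAt.continuousWithinAt) (fun θ _ => hφ θ)
    (fun θ hθ => mul_pos (hg _ (hmem θ)).2.1 (mul_pos hh (cos_pos_of_mem_Ioo hθ)))
    (fun θ _ => (ContinuousAt.comp (f := fun θ => h * sin θ)
      (hg _ (hmem θ)).1.deriv.continuousAt (hsin θ).continuousAt).continuousWithinAt)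
    (fun θ hθ => by
      have hc : 0 < h * cos θ := mul_pos hh (cos_pos_of_mem_Ioo hθ)
      have : 2 * (V (g h) - V (g (h * sin θ))) = (h * cos θ) ^ 2 := by
        rw [(hg _ (hmem θ)).2.2, (hg h ⟨by linarith, le_rfl⟩).2.2, mul_pow, mul_pow, cos_sq']
        ring
      simp only [this, sqrt_sq hc.le, mul_one_div, mul_div_cancel_right₀ _ hc.ne'])
  simpa using key

/-- Lower half-plane time in the coordinate that linearizes the potential. -/
lemma lower_time_eq {V g : ℝ → ℝ} {x : ℝ} (hx : 0 < x) (hg0 : g 0 = 0)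
    (hg : ∀ t ∈ Icc 0 (x ^ 2 / 2), AnalyticAt ℝ g t ∧ 0 < deriv g t ∧ V (-g t) = t) :
    IntervalIntegrable (fun y => 1 / √(2 * (x ^ 2 / 2 - V y))) volume (-g (x ^ 2 / 2)) 0 ∧
      ∫ y in (-g (x ^ 2 / 2))..0, 1 / √(2 * (x ^ 2 / 2 - V y)) =
        ∫ θ in (0 : ℝ)..(π / 2), deriv g ((x * cos θ) ^ 2 / 2) * (x * cos θ) := by
  have hmem : ∀ θ, (x * cos θ) ^ 2 / 2 ∈ Icc 0 (x ^ 2 / 2) := fun θ =>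
    ⟨by positivity, by nlinarith [cos_sq_le_one θ, sq_nonneg x]⟩
  have hcos : ∀ θ : ℝ,
      HasDerivAt (fun θ => (x * cos θ) ^ 2 / 2) (-(x * cos θ * (x * sin θ))) θ := fun θ => by
    convert! (((hasDerivAt_cos θ).const_mul x).pow 2).div_const 2 using 1
    push_cast
    ring
  have hφ : ∀ θ : ℝ, HasDerivAt (fun θ => -g ((x * cos θ) ^ 2 / 2))
      (deriv g ((x * cos θ) ^ 2 / 2) * (x * cos θ * (x * sin θ))) θ := fun θ => by
    convert! ((hg _ (hmem θ)).1.differentiableAt.hasDerivAt.comp θ (hcos θ)).neg using 1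
    ring
  have hpi : 0 < π / 2 := by positivity
  have hsin : ∀ θ ∈ Ioo 0 (π / 2), 0 < x * sin θ := fun θ hθ =>
    mul_pos hx (sin_pos_of_pos_of_lt_pi hθ.1 (by linarith [hθ.2]))
  have key := intervalIntegral_eq_of_increasing_change hpi
    (φ := fun θ => -g ((x * cos θ) ^ 2 / 2))
    (φ' := fun θ => deriv g ((x * cos θ) ^ 2 / 2) * (x * cos θ * (x * sin θ)))
    (F := fun y => 1 / √(2 * (x ^ 2 / 2 - V y)))
    (G := fun θ => deriv g ((x * cos θ) ^ 2 / 2) * (x * cos θ))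
    (fun θ _ => (hφ θ).continuousAt.continuousWithinAt) (fun θ _ => hφ θ)
    (fun θ hθ => mul_pos (hg _ (hmem θ)).2.1 (mul_pos
      (mul_pos hx (cos_pos_of_mem_Ioo ⟨by linarith [hθ.1], hθ.2⟩)) (hsin θ hθ)))
    (fun θ _ => ((ContinuousAt.comp (f := fun θ => (x * cos θ) ^ 2 / 2)
      (hg _ (hmem θ)).1.deriv.continuousAt (hcos θ).continuousAt).mul
      (by fun_prop)).continuousWithinAt)
    (fun θ hθ => by
      have hs := hsin θ hθ
      have : 2 * (x ^ 2 / 2 - V (-g ((x * cos θ) ^ 2 / 2))) = (x * sin θ) ^ 2 := by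
        rw [(hg _ (hmem θ)).2.2, mul_pow, mul_pow, sin_sq]
        ring
      simp only [this, sqrt_sq hs.le, mul_one_div, ← mul_assoc (deriv g _) (x * cos θ) _,
        mul_div_cancel_right₀ _ hs.ne'])
  simpa [hg0] using key

/-- Averaging `D (h * sin θ)` over a half period cancels the linear term of `D`. -/
lemma abs_integral_comp_mul_sin_sub_le {D : ℝ → ℝ} (hD : DifferentiableAt ℝ D 0)
    (hDc : ∀ᶠ t in 𝓝 0, ContinuousAt D t) {r : ℝ} (hr : 0 < r) :
    ∀ᶠ h in 𝓝 (0 : ℝ),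
      |(∫ θ in (-(π / 2))..(π / 2), D (h * sin θ)) - π * D 0| ≤ r * |h| := by
  have hlin : ∀ᶠ t in 𝓝 (0 : ℝ), |D t - D 0 - deriv D 0 * t| ≤ r / π * |t| := by
    filter_upwards [(hasDerivAt_iff_isLittleO.1 hD.hasDerivAt).def (div_pos hr pi_pos)] with t ht
    simpa [mul_comm] using ht
  obtain ⟨δ, hδ, hball⟩ := Metric.nhds_basis_closedBall.eventually_iff.1 (hDc.and hlin)
  filter_upwards [Metric.closedBall_mem_nhds (0 : ℝ) hδ] with h hh
  rw [mem_closedBall_zero_iff, norm_eq_abs] at hh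
  have hle : ∀ θ, |h * sin θ| ≤ |h| := fun θ => by
    rw [abs_mul]
    exact mul_le_of_le_one_right (abs_nonneg h) (abs_sin_le_one θ)
  have hmem : ∀ θ, h * sin θ ∈ Metric.closedBall (0 : ℝ) δ := fun θ => by
    rw [mem_closedBall_zero_iff, norm_eq_abs]
    exact (hle θ).trans hh
  have hcont : Continuous fun θ => D (h * sin θ) := continuous_iff_continuousAt.2 fun θ =>
    ContinuousAt.comp (f := fun θ => h * sin θ) (hball (hmem θ)).1 (by fun_prop)
  have hsplit : (∫ θ in (-(π / 2))..(π / 2), D (h * sin θ)) - π * D 0 =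
      ∫ θ in (-(π / 2))..(π / 2), (D (h * sin θ) - D 0 - deriv D 0 * (h * sin θ)) := by
    rw [intervalIntegral.integral_sub, intervalIntegral.integral_sub,
      intervalIntegral.integral_const, intervalIntegral.integral_const_mul,
      intervalIntegral.integral_const_mul, integral_sin]
    · simp
    all_goals
      refine Continuous.intervalIntegrable ?_ _ _
      first | fun_prop | exact hcont | exact hcont.sub continuous_const
  rw [hsplit, ← norm_eq_abs]
  refine (intervalIntegral.norm_integral_le_of_norm_le_const (C := r / π * |h|)
    fun θ _ => (hball (hmem θ)).2.trans ?_).trans_eq ?_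
  · exact mul_le_mul_of_nonneg_left (hle θ) (by positivity)
  · rw [sub_neg_eq_add, add_halves, abs_of_pos pi_pos]
    field_simp

/-- Small positive `x` are values `g h` with `h` small and comparable to `x`. -/
lemma AnalyticAt.eventually_exists_preimage {g : ℝ → ℝ} (hg : AnalyticAt ℝ g 0) (hg0 : g 0 = 0)
    (h1 : 0 < deriv g 0) {P : ℝ → Prop} (hP : ∀ᶠ h in 𝓝[>] 0, P h) :
    ∀ᶠ x in 𝓝[>] (0 : ℝ), ∃ h > 0, P h ∧ g h = x ∧ deriv g 0 / 2 * h ≤ x := by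
  obtain ⟨δ, hδ, hb⟩ := hg.exists_bounds_of_deriv_pos h1 (eventually_nhdsWithin_iff.1 hP)
  have hsub : Icc 0 δ ⊆ Icc (-δ) δ := Icc_subset_Icc_left (by linarith)
  have hcont : ContinuousOn g (Icc 0 δ) :=
    fun t ht => (hb t (hsub ht)).1.continuousAt.continuousWithinAt
  have hgδ : 0 < g δ := by
    rw [← hg0]
    exact strictMonoOn_of_analyticAt_deriv_pos (half_pos h1)
      (fun t ht => ⟨(hb t (hsub ht)).1, (hb t (hsub ht)).2.1⟩)
      (left_mem_Icc.2 hδ.le) (right_mem_Icc.2 hδ.le) hδ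
  filter_upwards [Ioo_mem_nhdsGT hgδ] with x hx
  rw [← hg0] at hx
  obtain ⟨h, hh, rfl⟩ := intermediate_value_Ioo hδ.le hcont hx
  refine ⟨h, hh.1, (hb h (hsub (Ioo_subset_Icc_self hh))).2.2.2 hh.1, rfl, ?_⟩
  have := (convex_Icc 0 δ).mul_sub_le_image_sub_of_le_deriv hcont
    (fun t ht => (hb t (hsub (interior_subset ht))).1.differentiableAt.differentiableWithinAt)
    (fun t ht => (hb t (hsub (interior_subset ht))).2.1)
    0 (left_mem_Icc.2 hδ.le) h (Ioo_subset_Icc_self hh) hh.1.le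
  simpa [hg0] using this

/-- The upper half-plane time converges and equals a constant up to `o(x)`. -/
lemma upper_time_asymptotics {V : ℝ → ℝ} (hV : AnalyticAt ℝ V 0) (h0 : V 0 = 0)
    (h1 : deriv V 0 = 0) (h2 : 0 < iteratedDeriv 2 V 0) {xminus : ℝ → ℝ}
    (hxminus : ∀ᶠ x in 𝓝[>] (0 : ℝ), xminus x < 0 ∧ V (xminus x) = V x ∧
      ∀ s ∈ Ioo (xminus x) 0, V s ≠ V x) :
    ∃ c, ∀ r > 0, ∀ᶠ x in 𝓝[>] (0 : ℝ),
      IntervalIntegrable (fun s => 1 / √(2 * (V x - V s))) volume (xminus x) x ∧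
      |(∫ s in xminus x..x, 1 / √(2 * (V x - V s))) - c| ≤ r * x := by
  obtain ⟨g, hg, hg0, hg1, hgV⟩ := hV.exists_morse_coordinate h0 h1 h2
  obtain ⟨δ, hδ, hb⟩ := hg.exists_bounds_of_deriv_pos hg1 hgV
  refine ⟨π * deriv g 0, fun r hr => ?_⟩
  have hlin := abs_integral_comp_mul_sin_sub_le hg.deriv.differentiableAt
    (hg.eventually_analyticAt.mono fun t ht => ht.deriv.continuousAt)
    (r := r * (deriv g 0 / 2)) (by positivity)
  have hev : ∀ᶠ h in 𝓝[>] (0 : ℝ), h ≤ δ ∧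
      |(∫ θ in (-(π / 2))..(π / 2), deriv g (h * sin θ)) - π * deriv g 0| ≤
        r * (deriv g 0 / 2) * |h| :=
    nhdsWithin_le_nhds ((eventually_le_nhds hδ).and hlin)
  filter_upwards [hxminus, hg.eventually_exists_preimage hg0 hg1 hev]
  rintro _ hxm ⟨h, hh, ⟨hhδ, hbound⟩, rfl, hhx⟩
  have hb' : ∀ t ∈ Icc (-h) h, AnalyticAt ℝ g t ∧ deriv g 0 / 2 ≤ deriv g t ∧
      V (g t) = t ^ 2 / 2 := fun t ht =>
    have := hb t ⟨by linarith [ht.1], ht.2.trans hhδ⟩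
    ⟨this.1, this.2.1, this.2.2.2⟩
  have hmono : StrictMonoOn g (Icc (-h) h) :=
    strictMonoOn_of_analyticAt_deriv_pos (half_pos hg1) fun t ht =>
      ⟨(hb' t ht).1, (hb' t ht).2.1⟩
  have hVh : V (g h) = h ^ 2 / 2 := (hb' h ⟨by linarith, le_rfl⟩).2.2
  have hxm_eq : xminus (g h) = g (-h) := by
    refine eq_of_largest_negative_solution hxm.1 hxm.2.1 hxm.2.2 ?_ ?_ ?_
    · rw [← hg0]
      exact hmono ⟨le_rfl, by linarith⟩ ⟨by linarith, hh.le⟩ (by linarith)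
    · rw [hVh, (hb' (-h) ⟨le_rfl, by linarith⟩).2.2, neg_sq]
    · intro s hs
      rw [← hg0] at hs
      obtain ⟨t, ht, rfl⟩ := intermediate_value_Ioo (by linarith : -h ≤ 0)
        (fun t ht => (hb' t ⟨ht.1, by linarith [ht.2]⟩).1.continuousAt.continuousWithinAt) hs
      rw [hVh, (hb' t ⟨ht.1.le, by linarith [ht.2]⟩).2.2]
      have : t ^ 2 < h ^ 2 := by nlinarith [ht.1, ht.2]
      exact ne_of_lt (by linarith)
  obtain ⟨hI, hE⟩ := upper_time_eq (V := V) (g := g) hh fun t ht =>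
    ⟨(hb' t ht).1, (half_pos hg1).trans_le (hb' t ht).2.1, (hb' t ht).2.2⟩
  rw [hxm_eq, hE]
  refine ⟨hI, hbound.trans ?_⟩
  rw [abs_of_pos hh, mul_assoc]
  exact mul_le_mul_of_nonneg_left hhx hr.le

/-- The lower half-plane time converges and is exactly of order `x`. -/
lemma lower_time_asymptotics {V : ℝ → ℝ} (hV : AnalyticAt ℝ V 0) (h0 : V 0 = 0)
    (h1 : deriv V 0 < 0) {ystar : ℝ → ℝ}
    (hystar : ∀ᶠ x in 𝓝[>] (0 : ℝ), ystar x < 0 ∧ V (ystar x) = x ^ 2 / 2 ∧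
      ∀ y ∈ Ioo (ystar x) 0, V y ≠ x ^ 2 / 2) :
    ∃ m > 0, ∃ M, ∀ᶠ x in 𝓝[>] (0 : ℝ),
      IntervalIntegrable (fun y => 1 / √(2 * (x ^ 2 / 2 - V y))) volume (ystar x) 0 ∧
      m * x ≤ ∫ y in ystar x..0, 1 / √(2 * (x ^ 2 / 2 - V y)) ∧
      ∫ y in ystar x..0, 1 / √(2 * (x ^ 2 / 2 - V y)) ≤ M * x := by
  have hu : AnalyticAt ℝ (fun s => V (-s)) 0 :=
    AnalyticAt.fun_comp (by rwa [neg_zero]) analyticAt_id.neg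
  obtain ⟨g, hg, hg0, hg1, hgV⟩ := hu.exists_right_inverse (by simpa using h0)
    (by rw [deriv_comp_neg, neg_zero]; linarith)
  obtain ⟨δ, hδ, hb⟩ := hg.exists_bounds_of_deriv_pos hg1 hgV
  refine ⟨deriv g 0 / 2, half_pos hg1, deriv g 0 + 1, ?_⟩
  have hsmall : ∀ᶠ x in 𝓝[>] (0 : ℝ), x ^ 2 / 2 ≤ δ := by
    have : ContinuousAt (fun x : ℝ => x ^ 2 / 2) 0 := by fun_prop
    exact nhdsWithin_le_nhds (this.eventually_le_const (by simpa using hδ))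
  filter_upwards [hystar, hsmall, self_mem_nhdsWithin] with x hys hxδ hx
  rw [mem_Ioi] at hx
  have hA : 0 < x ^ 2 / 2 := by positivity
  have hb' : ∀ t ∈ Icc 0 (x ^ 2 / 2), AnalyticAt ℝ g t ∧ deriv g 0 / 2 ≤ deriv g t ∧
      deriv g t ≤ deriv g 0 + 1 ∧ V (-g t) = t := fun t ht =>
    hb t ⟨by linarith [ht.1], ht.2.trans hxδ⟩
  have hgA : 0 < g (x ^ 2 / 2) := by
    rw [← hg0]
    exact strictMonoOn_of_analyticAt_deriv_pos (half_pos hg1)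
      (fun t ht => ⟨(hb' t ht).1, (hb' t ht).2.1⟩) (left_mem_Icc.2 hA.le)
      (right_mem_Icc.2 hA.le) hA
  have hys_eq : ystar x = -g (x ^ 2 / 2) := by
    refine eq_of_largest_negative_solution hys.1 hys.2.1 hys.2.2 (by linarith)
      (hb' _ (right_mem_Icc.2 hA.le)).2.2.2 ?_
    intro s hs
    have hs' : -s ∈ Ioo (g 0) (g (x ^ 2 / 2)) := by
      rw [hg0]
      exact ⟨by linarith [hs.2], by linarith [hs.1]⟩
    obtain ⟨t, ht, hts⟩ := intermediate_value_Ioo hA.le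
      (fun t ht => (hb' t ht).1.continuousAt.continuousWithinAt) hs'
    have hVs := (hb' t (Ioo_subset_Icc_self ht)).2.2.2
    rw [hts, neg_neg] at hVs
    rw [hVs]
    exact ht.2.ne
  obtain ⟨hI, hE⟩ := lower_time_eq (V := V) hx hg0 fun t ht =>
    ⟨(hb' t ht).1, (half_pos hg1).trans_le (hb' t ht).2.1, (hb' t ht).2.2.2⟩
  rw [hys_eq, hE]
  have hmem : ∀ θ, (x * cos θ) ^ 2 / 2 ∈ Icc 0 (x ^ 2 / 2) := fun θ =>
    ⟨by positivity, by nlinarith [cos_sq_le_one θ, sq_nonneg x]⟩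
  have hcos : ∀ θ ∈ Icc 0 (π / 2), 0 ≤ x * cos θ := fun θ hθ =>
    mul_nonneg hx.le (cos_nonneg_of_mem_Icc ⟨by linarith [hθ.1, pi_pos], hθ.2⟩)
  have hcont : Continuous fun θ => deriv g ((x * cos θ) ^ 2 / 2) * (x * cos θ) :=
    continuous_iff_continuousAt.2 fun θ =>
      (ContinuousAt.comp (f := fun θ => (x * cos θ) ^ 2 / 2)
        (hb' _ (hmem θ)).1.deriv.continuousAt (by fun_prop)).mul (by fun_prop)
  have hconst : ∀ k : ℝ, ∫ θ in (0 : ℝ)..(π / 2), k * (x * cos θ) = k * x := fun k => by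
    rw [intervalIntegral.integral_const_mul, intervalIntegral.integral_const_mul, integral_cos]
    simp
  refine ⟨hI, ?_, ?_⟩
  · rw [← hconst]
    exact intervalIntegral.integral_mono_on (by positivity)
      (Continuous.intervalIntegrable (by fun_prop) _ _) (hcont.intervalIntegrable _ _)
      fun θ hθ => mul_le_mul_of_nonneg_right (hb' _ (hmem θ)).2.1 (hcos θ hθ)
  · rw [← hconst]
    exact intervalIntegral.integral_mono_on (by positivity)
      (hcont.intervalIntegrable _ _) (Continuous.intervalIntegrable (by fun_prop) _ _)
      fun θ hθ => mul_le_mul_of_nonneg_right (hb' _ (hmem θ)).2.2.1 (hcos θ hθ)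

/-- **Theorem A.** The piecewise discontinuous system
`(ẋ,ẏ) = (y, -(V⁺)'(x))` for `y ≥ 0` and `(ẋ,ẏ) = ((V⁻)'(y), -x)` for `y < 0`,
with `V⁺(0) = V⁻(0) = 0`, `(V⁺)'(0) = 0`, `(V⁺)''(0) > 0` and `(V⁻)'(0) < 0`,
has no isochronous center at the origin: the period function
`T(x) = T⁺(x) + T⁻(x)` is non-constant on `(0, ε)` for every `ε > 0`. -/
theorem nonisochronous_piecewise_system_theoremA
    (Vp Vm : ℝ → ℝ)
    (hVpA : AnalyticAt ℝ Vp 0) (hVmA : AnalyticAt ℝ Vm 0)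
    (hVp0 : Vp 0 = 0) (hVm0 : Vm 0 = 0)
    (hVp1 : deriv Vp 0 = 0) (hVp2 : 0 < iteratedDeriv 2 Vp 0)
    (hVm1 : deriv Vm 0 < 0)
    -- `x₋(x) < 0` is the unique point near `0` with `V⁺(x₋(x)) = V⁺(x)`
    (xminus : ℝ → ℝ)
    (hxminus : ∀ᶠ x in 𝓝[>] (0:ℝ), xminus x < 0 ∧ Vp (xminus x) = Vp x ∧
      ∀ s ∈ Ioo (xminus x) 0, Vp s ≠ Vp x)
    -- `y⁎(x) < 0` is the unique point near `0` with `V⁻(y⁎(x)) = x²/2`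
    (ystar : ℝ → ℝ)
    (hystar : ∀ᶠ x in 𝓝[>] (0:ℝ), ystar x < 0 ∧ Vm (ystar x) = x ^ 2 / 2 ∧
      ∀ y ∈ Ioo (ystar x) 0, Vm y ≠ x ^ 2 / 2)
    -- the time spent in the upper half-plane
    (Tplus : ℝ → ℝ)
    (hTplus : ∀ x, Tplus x = ∫ s in xminus x..x, 1 / Real.sqrt (2 * (Vp x - Vp s)))
    -- the time spent in the lower half-plane
    (Tminus : ℝ → ℝ)
    (hTminus : ∀ x, Tminus x =
      2 * ∫ y in ystar x..0, 1 / Real.sqrt (2 * (x ^ 2 / 2 - Vm y)))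
    -- the period function of the piecewise system
    (T : ℝ → ℝ) (hT : ∀ x, T x = Tplus x + Tminus x) :
    -- both improper integrals converge, and `T` is non-constant on every `(0, ε)`
    (∀ᶠ x in 𝓝[>] (0:ℝ),
      IntervalIntegrable (fun s => 1 / Real.sqrt (2 * (Vp x - Vp s)))
        volume (xminus x) x ∧
      IntervalIntegrable (fun y => 1 / Real.sqrt (2 * (x ^ 2 / 2 - Vm y)))
        volume (ystar x) 0) ∧
    ∀ ε > (0:ℝ), ∃ x₁ ∈ Ioo (0:ℝ) ε, ∃ x₂ ∈ Ioo (0:ℝ) ε, T x₁ ≠ T x₂ := by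
  obtain ⟨c, hc⟩ := upper_time_asymptotics hVpA hVp0 hVp1 hVp2 hxminus
  obtain ⟨m, hm, M, hM⟩ := lower_time_asymptotics hVmA hVm0 hVm1 hystar
  refine ⟨?_, fun ε hε => ?_⟩
  · filter_upwards [hc 1 one_pos, hM] with x h₁ h₂
    exact ⟨h₁.1, h₂.1⟩
  · by_contra! hconst
    have hdist : ∀ᶠ x in 𝓝[>] (0 : ℝ), |T (ε / 2) - c| ≤ (1 + 2 * M) * x := by
      filter_upwards [hc 1 one_pos, hM, Ioo_mem_nhdsGT hε, self_mem_nhdsWithin]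
        with x h₁ h₂ hx hx0
      have hpos : 0 ≤ m * x := mul_nonneg hm.le (le_of_lt hx0)
      rw [← hconst x hx (ε / 2) ⟨half_pos hε, half_lt_self hε⟩, hT, hTplus, hTminus]
      have := abs_le.1 h₁.2
      exact abs_le.2 ⟨by linarith, by linarith⟩
    have hTc : T (ε / 2) = c := by
      have hlim : Tendsto (fun x : ℝ => (1 + 2 * M) * x) (𝓝[>] 0) (𝓝 0) := by
        have : ContinuousAt (fun x : ℝ => (1 + 2 * M) * x) 0 := by fun_prop
        simpa using this.tendsto.mono_left nhdsWithin_le_nhds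
      exact sub_eq_zero.1 (abs_eq_zero.1 (le_antisymm (ge_of_tendsto hlim hdist) (abs_nonneg _)))
    obtain ⟨x, h₁, h₂, hx⟩ :=
      ((hc m hm).and (hM.and (Ioo_mem_nhdsGT hε))).exists
    have hTx := hconst x hx (ε / 2) ⟨half_pos hε, half_lt_self hε⟩
    rw [hTc, hT, hTplus, hTminus] at hTx
    have := (abs_le.1 h₁.2).1
    nlinarith [mul_pos hm hx.1, h₂.2.1]
end

section
/- Consider the planar piecewise discontinuous differential system given by (ẋ, ẏ) = (y, −(V⁺)′(x)) for y ≥ 0 and (ẋ, ẏ) = ((V⁻)′(y), −x) for y < 0, where V⁺ and V⁻ are real-analytic near 0 with V⁺(0) = V⁻(0) = 0, (V⁺)′(0) = 0, (V⁺)″(0) = 2ω² for some ω > 0, and (V⁻)′(0) < 0. Then the period function satisfies lim_{x→0⁺} T(x) = π/(√2 ω), and the first period constant is T₁ = lim_{x→0⁺} (T(x) − π/(√2 ω))/x = −2/(V⁻)′(0) > 0. -/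
open Real Filter Set Topology MeasureTheory intervalIntegral

/-- An analytic function vanishing to order exactly two at `0`, with positive second derivative, is
locally the square of an analytic function with positive derivative at `0`. -/
theorem exists_analyticAt_sq_eq {V : ℝ → ℝ} (hV : AnalyticAt ℝ V 0) (h0 : V 0 = 0)
    (h1 : deriv V 0 = 0) {ω : ℝ} (hω : 0 < ω) (h2 : iteratedDeriv 2 V 0 = 2 * ω ^ 2) :
    ∃ g : ℝ → ℝ, AnalyticAt ℝ g 0 ∧ g 0 = 0 ∧ deriv g 0 = ω ∧
      ∀ᶠ s in 𝓝 0, V s = g s ^ 2 := by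
  obtain ⟨k, hk, hVk⟩ := (natCast_le_analyticOrderAt hV (n := 2)).1 <|
    (natCast_le_analyticOrderAt_iff_iteratedDeriv_eq_zero hV).2 fun i hi => by
      interval_cases i <;> simp [h0, h1]
  simp only [sub_zero, smul_eq_mul] at hVk
  have hk0 : k 0 = ω ^ 2 := by
    have hd : deriv V =ᶠ[𝓝 0] fun s => 2 * s * k s + s ^ 2 * deriv k s := by
      filter_upwards [hVk.eventually_nhds, hk.eventually_analyticAt] with s hs hks
      have : HasDerivAt (fun s => s ^ 2 * k s) (2 * s * k s + s ^ 2 * deriv k s) s := by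
        simpa using! (hasDerivAt_pow 2 s).mul hks.differentiableAt.hasDerivAt
      exact (this.congr_of_eventuallyEq hs).deriv
    have hdd : HasDerivAt (fun s => 2 * s * k s + s ^ 2 * deriv k s) (2 * k 0) 0 := by
      have := (((hasDerivAt_id (0 : ℝ)).const_mul 2).mul hk.differentiableAt.hasDerivAt).add
        ((hasDerivAt_pow 2 (0 : ℝ)).mul hk.deriv.differentiableAt.hasDerivAt)
      simpa using! this
    rw [iteratedDeriv_succ, iteratedDeriv_one, (hdd.congr_of_eventuallyEq hd).deriv] at h2
    linarith
  have hkpos : ∀ᶠ s in 𝓝 0, 0 < k s :=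
    hk.continuousAt.eventually_const_lt (by rw [hk0]; positivity)
  have hsqrt : AnalyticAt ℝ (fun s => √(k s)) 0 :=
    (hk.contDiffAt.sqrt (by rw [hk0]; positivity) (n := ⊤)).analyticAt
  refine ⟨fun s => s * √(k s), analyticAt_id.mul hsqrt, by simp, ?_, ?_⟩
  · have := (hasDerivAt_id (0 : ℝ)).mul hsqrt.differentiableAt.hasDerivAt
    have h := this.deriv
    simpa [hk0, sqrt_sq hω.le] using! h
  · filter_upwards [hVk, hkpos] with s hs hks
    rw [hs, mul_pow, sq_sqrt hks.le]

/-- The analytic inverse function theorem at a fixed point `0`. -/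
theorem AnalyticAt.exists_local_inverse {g : ℝ → ℝ} (hg : AnalyticAt ℝ g 0) (h0 : g 0 = 0)
    (h1 : deriv g 0 ≠ 0) :
    ∃ φ : ℝ → ℝ, AnalyticAt ℝ φ 0 ∧ φ 0 = 0 ∧ deriv φ 0 = (deriv g 0)⁻¹ ∧
      (∀ᶠ u in 𝓝 0, g (φ u) = u) ∧ ∀ᶠ s in 𝓝 0, φ (g s) = s := by
  have hs := hg.hasStrictDerivAt
  have hl := hs.eventually_left_inverse h1
  have hr := hs.eventually_right_inverse h1
  have hd := hs.to_localInverse h1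
  have ha := hg.analyticAt_localInverse h1
  rw [h0] at hr hd ha
  refine ⟨_, ha, ?_, hd.hasDerivAt.deriv, hr, hl⟩
  simpa [h0] using hl.self_of_nhds

theorem isLittleO_integral_comp_mul {p w : ℝ → ℝ} {a b : ℝ} (hp : p =o[𝓝 0] fun u => u)
    (hw : ∀ θ ∈ uIcc a b, |w θ| ≤ 1) : (fun r => ∫ θ in a..b, p (r * w θ)) =o[𝓝 0] fun r => r := by
  refine Asymptotics.isLittleO_iff.2 fun c hc => ?_
  have hc' : 0 < c / (|b - a| + 1) := by positivity
  obtain ⟨ε, hε, hball⟩ := Metric.eventually_nhds_iff.1 (Asymptotics.isLittleO_iff.1 hp hc')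
  refine Metric.eventually_nhds_iff.2 ⟨ε, hε, fun r hr => ?_⟩
  have hrw : ∀ θ ∈ uIoc a b, |r * w θ| ≤ |r| := fun θ hθ => by
    rw [abs_mul]
    exact mul_le_of_le_one_right (abs_nonneg r) (hw θ (uIoc_subset_uIcc hθ))
  simp only [dist_zero_right, norm_eq_abs] at hr hball ⊢
  have hbound : ∀ θ ∈ uIoc a b, ‖p (r * w θ)‖ ≤ c / (|b - a| + 1) * |r| := fun θ hθ =>
    (hball ((hrw θ hθ).trans_lt hr)).trans (mul_le_mul_of_nonneg_left (hrw θ hθ) hc'.le)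
  calc |∫ θ in a..b, p (r * w θ)| ≤ c / (|b - a| + 1) * |r| * |b - a| :=
        norm_integral_le_of_norm_le_const hbound
    _ = c * |r| * (|b - a| / (|b - a| + 1)) := by ring
    _ ≤ c * |r| := mul_le_of_le_one_right (by positivity)
        ((div_le_one (by positivity)).2 (by linarith))

/-- Differentiation under the integral sign at `r = 0` for `r ↦ ∫ f (r * w θ) dθ`. -/
theorem AnalyticAt.hasDerivAt_integral_comp_mul {f w : ℝ → ℝ} {a b : ℝ} (hf : AnalyticAt ℝ f 0)
    (hwc : Continuous w) (hw : ∀ θ ∈ uIcc a b, |w θ| ≤ 1) :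
    HasDerivAt (fun r => ∫ θ in a..b, f (r * w θ)) (deriv f 0 * ∫ θ in a..b, w θ) 0 := by
  have hp : (fun u => f u - f 0 - u * deriv f 0) =o[𝓝 0] fun u => u := by
    simpa using hasDerivAt_iff_isLittleO.1 hf.differentiableAt.hasDerivAt
  rw [hasDerivAt_iff_isLittleO_nhds_zero]
  refine (isLittleO_integral_comp_mul (a := a) (b := b) hp hw).congr' ?_ .rfl
  obtain ⟨ε, hε, hball⟩ := Metric.eventually_nhds_iff.1 hf.eventually_analyticAt
  refine Metric.eventually_nhds_iff.2 ⟨ε, hε, fun r hr => ?_⟩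
  have hfint : IntervalIntegrable (fun θ => f (r * w θ)) volume a b := by
    refine ContinuousOn.intervalIntegrable fun θ hθ => ContinuousAt.continuousWithinAt ?_
    have hθ' : dist (r * w θ) 0 < ε := by
      simp only [dist_zero_right, norm_eq_abs] at hr ⊢
      rw [abs_mul]
      exact (mul_le_of_le_one_right (abs_nonneg r) (hw θ hθ)).trans_lt hr
    exact ContinuousAt.comp (f := fun θ => r * w θ) (hball hθ').continuousAt (by fun_prop)
  have hconst : IntervalIntegrable (fun _ => f 0) volume a b := intervalIntegrable_const
  have hlin : IntervalIntegrable (fun θ => r * deriv f 0 * w θ) volume a b :=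
    Continuous.intervalIntegrable (by fun_prop) _ _
  calc ∫ θ in a..b, (f (r * w θ) - f 0 - r * w θ * deriv f 0)
      = ∫ θ in a..b, (f (r * w θ) - f 0 - r * deriv f 0 * w θ) := by simp only [mul_right_comm]
    _ = _ := by
      rw [intervalIntegral.integral_sub (hfint.sub hconst) hlin,
        intervalIntegral.integral_sub hfint hconst, intervalIntegral.integral_const_mul]
      simp [mul_assoc]

/-- In the coordinate `u = r sin θ` with `V (φ u) = u ^ 2` the time integral is regular. -/
theorem integral_inv_sqrt_eq_integral_sin {V φ : ℝ → ℝ} {r : ℝ} (hr : 0 < r)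
    (hd : ∀ u ∈ Icc (-r) r, DifferentiableAt ℝ φ u) (hpos : ∀ u ∈ Icc (-r) r, 0 < deriv φ u)
    (hV : ∀ u ∈ Icc (-r) r, V (φ u) = u ^ 2) :
    ∫ s in φ (-r)..φ r, 1 / √(2 * (V (φ r) - V s)) =
      (∫ θ in -(π / 2)..π / 2, deriv φ (r * sin θ)) / √2 := by
  have hab : -(π / 2) ≤ π / 2 := by linarith [pi_pos]
  have hmem : ∀ θ, r * sin θ ∈ Icc (-r) r := fun θ =>
    ⟨by nlinarith [neg_one_le_sin θ], by nlinarith [sin_le_one θ]⟩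
  have hderiv : ∀ θ, HasDerivAt (fun θ => φ (r * sin θ)) (deriv φ (r * sin θ) * (r * cos θ)) θ :=
    fun θ => (hd _ (hmem θ)).hasDerivAt.comp θ ((hasDerivAt_sin θ).const_mul r)
  have hsub := integral_comp_mul_deriv_of_deriv_nonneg (a := -(π / 2)) (b := π / 2)
    (f := fun θ => φ (r * sin θ)) (f' := fun θ => deriv φ (r * sin θ) * (r * cos θ))
    (g := fun s => 1 / √(2 * (V (φ r) - V s)))
    (fun θ _ => (hderiv θ).continuousAt.continuousWithinAt) (fun θ _ => hderiv θ)
    (fun θ hθ => by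
      rw [min_eq_left hab, max_eq_right hab] at hθ
      have := hpos _ (hmem θ)
      have := cos_pos_of_mem_Ioo hθ
      positivity)
  simp only [sin_neg, sin_pi_div_two, mul_neg, mul_one] at hsub
  rw [← hsub, ← intervalIntegral.integral_div]
  refine integral_congr_Ioo_of_le hab fun θ hθ => ?_
  have hcos := cos_pos_of_mem_Ioo hθ
  have hsqrt : √(2 * (V (φ r) - V (φ (r * sin θ)))) = √2 * (r * cos θ) := by
    rw [hV _ (hmem θ), hV r ⟨by linarith, le_rfl⟩,
      show 2 * (r ^ 2 - (r * sin θ) ^ 2) = 2 * (r * cos θ) ^ 2 by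
        linear_combination 2 * r ^ 2 * (sin_sq_add_cos_sq θ).symm,
      sqrt_mul zero_le_two, sqrt_sq (by positivity)]
  simp only [Function.comp_apply, hsqrt]
  field_simp

/-- In the coordinate `x ^ 2 / 2 * (1 - t ^ 2)` with `V (φ u) = u` the time integral is regular. -/
theorem integral_inv_sqrt_eq_integral_one_sub_sq {V φ : ℝ → ℝ} {x : ℝ} (hx : 0 < x)
    (hd : ∀ u ∈ Icc 0 (x ^ 2 / 2), DifferentiableAt ℝ φ u)
    (hneg : ∀ u ∈ Icc 0 (x ^ 2 / 2), deriv φ u < 0)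
    (hV : ∀ u ∈ Icc 0 (x ^ 2 / 2), V (φ u) = u) :
    ∫ y in φ (x ^ 2 / 2)..φ 0, 1 / √(2 * (x ^ 2 / 2 - V y)) =
      -x * ∫ t in 0..1, deriv φ (x ^ 2 / 2 * (1 - t ^ 2)) := by
  have hmem : ∀ t ∈ Icc (0 : ℝ) 1, x ^ 2 / 2 * (1 - t ^ 2) ∈ Icc 0 (x ^ 2 / 2) := fun t ht => by
    have h1 : t ^ 2 ≤ 1 := pow_le_one₀ ht.1 ht.2
    exact ⟨mul_nonneg (by positivity) (by linarith),
      mul_le_of_le_one_right (by positivity) (by nlinarith)⟩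
  have hderiv : ∀ t ∈ Icc (0 : ℝ) 1, HasDerivAt (fun t => φ (x ^ 2 / 2 * (1 - t ^ 2)))
      (deriv φ (x ^ 2 / 2 * (1 - t ^ 2)) * (-x ^ 2 * t)) t := fun t ht => by
    have hin : HasDerivAt (fun t : ℝ => x ^ 2 / 2 * (1 - t ^ 2)) (-x ^ 2 * t) t := by
      refine (((hasDerivAt_pow 2 t).const_sub 1).const_mul (x ^ 2 / 2)).congr_deriv ?_
      push_cast
      ring
    exact (hd _ (hmem t ht)).hasDerivAt.comp t hin
  have hsub := integral_comp_mul_deriv_of_deriv_nonneg (a := 0) (b := 1)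
    (f := fun t => φ (x ^ 2 / 2 * (1 - t ^ 2)))
    (f' := fun t => deriv φ (x ^ 2 / 2 * (1 - t ^ 2)) * (-x ^ 2 * t))
    (g := fun y => 1 / √(2 * (x ^ 2 / 2 - V y)))
    (fun t ht => (hderiv t (by simpa using ht)).continuousAt.continuousWithinAt)
    (fun t ht => hderiv t (Ioo_subset_Icc_self (by simpa using ht)))
    (fun t ht => by
      have ht' : t ∈ Ioo (0 : ℝ) 1 := by simpa using ht
      have h1 := hneg _ (hmem t (Ioo_subset_Icc_self ht'))
      have h2 : 0 < x ^ 2 * t := mul_pos (by positivity) ht'.1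
      nlinarith)
  simp only [one_pow, sub_self, mul_zero, ne_eq, OfNat.ofNat_ne_zero, not_false_eq_true, zero_pow,
    sub_zero, mul_one] at hsub
  rw [← hsub, ← intervalIntegral.integral_const_mul]
  refine integral_congr_Ioo_of_le zero_le_one fun t ht => ?_
  have ht0 := ht.1
  have hsqrt : √(2 * (x ^ 2 / 2 - V (φ (x ^ 2 / 2 * (1 - t ^ 2))))) = x * t := by
    rw [hV _ (hmem t (Ioo_subset_Icc_self ht)),
      show 2 * (x ^ 2 / 2 - x ^ 2 / 2 * (1 - t ^ 2)) = (x * t) ^ 2 by ring,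
      sqrt_sq (by positivity)]
  simp only [Function.comp_apply, hsqrt]
  field_simp

/-- A first negative solution `z x` of `V = c x` coincides, for small `x > 0`, with any negative
solution `m x` that tends to `0`, provided `V` is injective on small negative numbers. -/
theorem eventually_first_solution_eq {V c m z : ℝ → ℝ} (hm : Tendsto m (𝓝[>] 0) (𝓝 0))
    (hm_neg : ∀ᶠ x in 𝓝[>] 0, m x < 0) (hVm : ∀ᶠ x in 𝓝[>] 0, V (m x) = c x)
    (hz : ∀ᶠ x in 𝓝[>] 0, z x < 0 ∧ V (z x) = c x ∧ ∀ s ∈ Ioo (z x) 0, V s ≠ c x)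
    {k : ℝ → ℝ} (hk : ∀ᶠ s in 𝓝 0, s < 0 → k (V s) = s) :
    ∀ᶠ x in 𝓝[>] 0, z x = m x := by
  have hle : ∀ᶠ x in 𝓝[>] 0, m x ≤ z x := by
    filter_upwards [hm_neg, hVm, hz] with x h1 h2 h3
    by_contra! hlt
    exact h3.2.2 _ ⟨hlt, h1⟩ h2
  have hzlim : Tendsto z (𝓝[>] 0) (𝓝 0) := tendsto_of_tendsto_of_tendsto_of_le_of_le' hm
    tendsto_const_nhds hle (hz.mono fun x hx => hx.1.le)
  filter_upwards [hm_neg, hVm, hz, hzlim.eventually hk, hm.eventually hk] with x h1 h2 h3 h4 h5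
  rw [← h4 h3.1, ← h5 h1, h2, h3.2.1]

/-- The time spent in the upper half-plane extends differentiably to amplitude `0`, with vanishing
derivative there. -/
theorem exists_upper_time_extension {V : ℝ → ℝ} (hV : AnalyticAt ℝ V 0) (h0 : V 0 = 0)
    (h1 : deriv V 0 = 0) {ω : ℝ} (hω : 0 < ω) (h2 : iteratedDeriv 2 V 0 = 2 * ω ^ 2)
    {z : ℝ → ℝ} (hz : ∀ᶠ x in 𝓝[>] 0, z x < 0 ∧ V (z x) = V x ∧ ∀ s ∈ Ioo (z x) 0, V s ≠ V x) :
    ∃ F : ℝ → ℝ, HasDerivAt F 0 0 ∧ F 0 = π / (√2 * ω) ∧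
      ∀ᶠ x in 𝓝[>] 0, ∫ s in z x..x, 1 / √(2 * (V x - V s)) = F x := by
  obtain ⟨g, hg, hg0, hg1, hVg⟩ := exists_analyticAt_sq_eq hV h0 h1 hω h2
  obtain ⟨φ, hφ, hφ0, hφ1, hgφ, hφg⟩ := hg.exists_local_inverse hg0 (by rw [hg1]; exact hω.ne')
  rw [hg1] at hφ1
  have hφpos : 0 < deriv φ 0 := by rw [hφ1]; positivity
  have hgsign := eventually_nhdsWithin_sign_eq_of_deriv_pos (hg1 ▸ hω) hg0
  have hφsign := eventually_nhdsWithin_sign_eq_of_deriv_pos hφpos hφ0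
  simp only [sub_zero] at hgsign hφsign
  have hφlim : Tendsto φ (𝓝 0) (𝓝 0) := by simpa [hφ0] using hφ.continuousAt.tendsto
  have hglim : Tendsto g (𝓝[>] 0) (𝓝 0) := by
    simpa [hg0] using hg.continuousAt.tendsto.mono_left (nhdsWithin_le_nhds (s := Ioi 0))
  have hneglim : Tendsto (fun x => -g x) (𝓝[>] 0) (𝓝 0) := by simpa using hglim.neg
  have hgpos : ∀ᶠ x in 𝓝[>] 0, 0 < g x := by
    filter_upwards [nhdsWithin_le_nhds hgsign, self_mem_nhdsWithin] with x hx hx0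
    rwa [sign_pos (mem_Ioi.1 hx0), sign_eq_one_iff] at hx
  have hVφ : ∀ᶠ u in 𝓝 0, V (φ u) = u ^ 2 := by
    filter_upwards [hφlim.eventually hVg, hgφ] with u hu hu'
    rw [hu, hu']
  have hzeq : ∀ᶠ x in 𝓝[>] 0, z x = φ (-g x) := by
    refine eventually_first_solution_eq (V := V) (c := V) (k := fun v => φ (-√v))
      (hφlim.comp hneglim) ?_ ?_ hz ?_
    · filter_upwards [hneglim.eventually hφsign, hgpos] with x hx hgx
      rwa [sign_neg (neg_neg_of_pos hgx), sign_eq_neg_one_iff] at hx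
    · filter_upwards [hneglim.eventually hVφ, nhdsWithin_le_nhds hVg] with x hx hx'
      rw [hx, hx', neg_sq]
    · filter_upwards [hVg, hgsign, hφg] with s hs hsign hinv hneg
      rw [sign_neg hneg, sign_eq_neg_one_iff] at hsign
      rw [hs, sqrt_sq_eq_abs, abs_of_neg hsign, neg_neg, hinv]
  refine ⟨fun x => (∫ θ in -(π / 2)..π / 2, deriv φ (g x * sin θ)) / √2, ?_, ?_, ?_⟩
  · have hF := hφ.deriv.hasDerivAt_integral_comp_mul (a := -(π / 2)) (b := π / 2)
      continuous_sin fun θ _ => abs_sin_le_one θ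
    rw [← hg0] at hF
    simpa [Function.comp_def] using!
      (hF.comp 0 hg.differentiableAt.hasDerivAt).div_const √2
  · simp only [hg0, zero_mul, intervalIntegral.integral_const, hφ1, smul_eq_mul]
    field_simp
    ring
  · obtain ⟨ε, hε, hball⟩ := Metric.eventually_nhds_iff.1 <|
      (hφ.eventually_analyticAt.and
        (hφ.deriv.continuousAt.eventually_const_lt hφpos)).and hVφ
    filter_upwards [hzeq, hgpos, hglim.eventually (Metric.ball_mem_nhds 0 hε),
      nhdsWithin_le_nhds hφg] with x hzx hgx hgε hinv
    rw [dist_zero_right, norm_eq_abs, abs_of_pos hgx] at hgε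
    have hu : ∀ u ∈ Icc (-g x) (g x), dist u 0 < ε := fun u hu => by
      rw [dist_zero_right, norm_eq_abs]
      exact (abs_le.2 hu).trans_lt hgε
    have := integral_inv_sqrt_eq_integral_sin hgx
      (fun u h => (hball (hu u h)).1.1.differentiableAt) (fun u h => (hball (hu u h)).1.2)
      (fun u h => (hball (hu u h)).2)
    rwa [← hzx, hinv] at this

/-- The time spent in the lower half-plane extends differentiably to amplitude `0`. -/
theorem exists_lower_time_extension {V : ℝ → ℝ} (hV : AnalyticAt ℝ V 0) (h0 : V 0 = 0)
    (h1 : deriv V 0 < 0) {z : ℝ → ℝ} (hz : ∀ᶠ x in 𝓝[>] (0 : ℝ), z x < 0 ∧ V (z x) = x ^ 2 / 2 ∧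
      ∀ y ∈ Ioo (z x) 0, V y ≠ x ^ 2 / 2) :
    ∃ F : ℝ → ℝ, HasDerivAt F (-2 / deriv V 0) 0 ∧ F 0 = 0 ∧
      ∀ᶠ x in 𝓝[>] (0 : ℝ), 2 * ∫ y in z x..0, 1 / √(2 * (x ^ 2 / 2 - V y)) = F x := by
  obtain ⟨φ, hφ, hφ0, hφ1, hVφ, hφV⟩ := hV.exists_local_inverse h0 h1.ne
  have hφneg : deriv φ 0 < 0 := by rw [hφ1]; exact inv_lt_zero.2 h1
  have hφsign := eventually_nhdsWithin_sign_eq_of_deriv_neg hφneg hφ0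
  have hE : Tendsto (fun x : ℝ => x ^ 2 / 2) (𝓝[>] 0) (𝓝 0) := by
    have : ContinuousAt (fun x : ℝ => x ^ 2 / 2) 0 := by fun_prop
    simpa using this.tendsto.mono_left (nhdsWithin_le_nhds (s := Ioi 0))
  have hφlim : Tendsto φ (𝓝 0) (𝓝 0) := by simpa [hφ0] using hφ.continuousAt.tendsto
  have hzeq : ∀ᶠ x in 𝓝[>] 0, z x = φ (x ^ 2 / 2) := by
    refine eventually_first_solution_eq (V := V) (c := fun x => x ^ 2 / 2) (k := φ)
      (hφlim.comp hE) ?_ (hE.eventually hVφ) hz (hφV.mono fun s hs _ => hs)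
    filter_upwards [hE.eventually hφsign, self_mem_nhdsWithin] with x hx hx0
    have hx0' : 0 < x := hx0
    rwa [zero_sub, sign_neg (neg_neg_of_pos (by positivity)), sign_eq_neg_one_iff] at hx
  refine ⟨fun x => x * (-2 * ∫ t in 0..1, deriv φ (x ^ 2 / 2 * (1 - t ^ 2))), ?_, by simp, ?_⟩
  · have hF := hφ.deriv.hasDerivAt_integral_comp_mul (w := fun t => 1 - t ^ 2) (a := 0) (b := 1)
      (by fun_prop) fun t ht => by
        rw [uIcc_of_le zero_le_one] at ht
        exact abs_le.2 ⟨by nlinarith [ht.1, ht.2], by nlinarith⟩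
    have hEd : HasDerivAt (fun x : ℝ => x ^ 2 / 2) 0 0 := by
      simpa using (hasDerivAt_pow 2 (0 : ℝ)).div_const 2
    refine ((hasDerivAt_id (0 : ℝ)).mul
      ((hF.comp_of_eq 0 hEd (by norm_num)).const_mul (-2))).congr_deriv ?_
    simp [hφ1, div_eq_mul_inv]
  · obtain ⟨ε, hε, hball⟩ := Metric.eventually_nhds_iff.1 <|
      (hφ.eventually_analyticAt.and
        (hφ.deriv.continuousAt.eventually_lt_const hφneg)).and hVφ
    filter_upwards [hzeq, self_mem_nhdsWithin, hE.eventually (Metric.ball_mem_nhds 0 hε)]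
      with x hzx hx hxε
    have hu : ∀ u ∈ Icc 0 (x ^ 2 / 2), dist u 0 < ε := fun u hu => by
      rw [dist_zero_right, norm_eq_abs, abs_of_nonneg (by positivity)] at hxε
      rw [dist_zero_right, norm_eq_abs, abs_of_nonneg hu.1]
      exact hu.2.trans_lt hxε
    have := integral_inv_sqrt_eq_integral_one_sub_sq hx
      (fun u h => (hball (hu u h)).1.1.differentiableAt) (fun u h => (hball (hu u h)).1.2)
      (fun u h => (hball (hu u h)).2)
    rw [← hzx, hφ0] at this
    rw [this]
    ring

/-- For the piecewise discontinuous system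
`(ẋ,ẏ) = (y, -(V⁺)'(x))` for `y ≥ 0` and `(ẋ,ẏ) = ((V⁻)'(y), -x)` for `y < 0`,
with `V⁺(0) = V⁻(0) = 0`, `(V⁺)'(0) = 0`, `(V⁺)''(0) = 2ω² > 0` and `(V⁻)'(0) < 0`,
the period function satisfies `lim_{x→0⁺} T(x) = π/(√2 ω)` and the first period
constant is `T₁ = lim_{x→0⁺} (T(x) - π/(√2 ω))/x = -2/(V⁻)'(0) > 0`. -/
theorem first_period_constant_piecewise_system
    (Vp Vm : ℝ → ℝ)
    (hVpA : AnalyticAt ℝ Vp 0) (hVmA : AnalyticAt ℝ Vm 0)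
    (hVp0 : Vp 0 = 0) (hVm0 : Vm 0 = 0)
    (hVp1 : deriv Vp 0 = 0)
    (ω : ℝ) (hω : 0 < ω) (hVp2 : iteratedDeriv 2 Vp 0 = 2 * ω ^ 2)
    (hVm1 : deriv Vm 0 < 0)
    -- `x₋(x) < 0` is the unique point near `0` with `V⁺(x₋(x)) = V⁺(x)`
    (xminus : ℝ → ℝ)
    (hxminus : ∀ᶠ x in 𝓝[>] (0:ℝ), xminus x < 0 ∧ Vp (xminus x) = Vp x ∧
      ∀ s ∈ Ioo (xminus x) 0, Vp s ≠ Vp x)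
    -- `y⁎(x) < 0` is the unique point near `0` with `V⁻(y⁎(x)) = x²/2`
    (ystar : ℝ → ℝ)
    (hystar : ∀ᶠ x in 𝓝[>] (0:ℝ), ystar x < 0 ∧ Vm (ystar x) = x ^ 2 / 2 ∧
      ∀ y ∈ Ioo (ystar x) 0, Vm y ≠ x ^ 2 / 2)
    -- the time spent in the upper half-plane
    (Tplus : ℝ → ℝ)
    (hTplus : ∀ x, Tplus x = ∫ s in xminus x..x, 1 / Real.sqrt (2 * (Vp x - Vp s)))
    -- the time spent in the lower half-plane
    (Tminus : ℝ → ℝ)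
    (hTminus : ∀ x, Tminus x =
      2 * ∫ y in ystar x..0, 1 / Real.sqrt (2 * (x ^ 2 / 2 - Vm y)))
    -- the period function of the piecewise system
    (T : ℝ → ℝ) (hT : ∀ x, T x = Tplus x + Tminus x) :
    Tendsto T (𝓝[>] (0:ℝ)) (𝓝 (π / (Real.sqrt 2 * ω))) ∧
    Tendsto (fun x => (T x - π / (Real.sqrt 2 * ω)) / x) (𝓝[>] (0:ℝ))
      (𝓝 (-2 / deriv Vm 0)) ∧
    0 < -2 / deriv Vm 0 := by
  obtain ⟨F, hF, hF0, hFT⟩ := exists_upper_time_extension hVpA hVp0 hVp1 hω hVp2 hxminus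
  obtain ⟨G, hG, hG0, hGT⟩ := exists_lower_time_extension hVmA hVm0 hVm1 hystar
  have hFG : HasDerivAt (fun x => F x + G x) (-2 / deriv Vm 0) 0 := by simpa using! hF.add hG
  have hTFG : T =ᶠ[𝓝[>] 0] fun x => F x + G x := by
    filter_upwards [hFT, hGT] with x h1 h2
    rw [hT, hTplus, hTminus, h1, h2]
  refine ⟨?_, ?_, div_pos_of_neg_of_neg (by norm_num) hVm1⟩
  · refine Tendsto.congr' hTFG.symm ?_
    simpa [hF0, hG0] using hFG.continuousAt.tendsto.mono_left (nhdsWithin_le_nhds (s := Ioi 0))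
  · refine hFG.tendsto_slope_zero_right.congr' ?_
    filter_upwards [hTFG] with x hx
    rw [hx, zero_add, hF0, hG0, add_zero, smul_eq_mul]
    ring
end

section
/- Suppose V⁺ vanishes to order m⁺ ≥ 1 at 0 and V⁻ vanishes to order m⁻ ≥ 1 at 0, with V(x) > 0 for all x ∈ (−δ, 0) ∪ (0, δ), and suppose max(m⁺, m⁻) ≥ 3. Then the period function T(h) of the non-smooth center at the origin is non-constant on (0, h₀) for every h₀ > 0; that is, the center is not isochronous. (This covers cases (ii), (iii), (vi), (vii) and (viii) of Theorem B.) -/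
open Real Filter Set Topology MeasureTheory intervalIntegral

/-- A function with a zero of exact order `m`, read off from its iterated derivatives, factors as
`x ^ m` times a non-vanishing analytic function. -/
theorem AnalyticAt.exists_eq_pow_mul_of_iteratedDeriv {W : ℝ → ℝ} {m : ℕ} (hW : AnalyticAt ℝ W 0)
    (h0 : ∀ k < m, iteratedDeriv k W 0 = 0) (hm : iteratedDeriv m W 0 ≠ 0) :
    ∃ u : ℝ → ℝ, AnalyticAt ℝ u 0 ∧ u 0 ≠ 0 ∧ ∀ᶠ x in 𝓝 0, W x = x ^ m * u x := by
  have hle : (m : ℕ∞) ≤ analyticOrderAt W 0 :=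
    (natCast_le_analyticOrderAt_iff_iteratedDeriv_eq_zero hW).2 h0
  have hlt : ¬ ((m + 1 : ℕ) : ℕ∞) ≤ analyticOrderAt W 0 := fun h ↦
    hm ((natCast_le_analyticOrderAt_iff_iteratedDeriv_eq_zero hW).1 h m m.lt_succ_self)
  have heq : analyticOrderAt W 0 = m := by
    refine le_antisymm ?_ hle
    rw [Nat.cast_add, Nat.cast_one] at hlt
    exact (ENat.lt_add_one_iff (ENat.natCast_ne_top m)).1 (not_le.1 hlt)
  simpa using hW.analyticOrderAt_eq_natCast.1 heq

/-- To the right of a zero of order `m ≥ 1` at `0`, an analytic function `W` is bounded above by a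
multiple of `x ^ m`, and `W ^ 2 / x` is nondecreasing. -/
theorem AnalyticAt.exists_right_bounds {W : ℝ → ℝ} {m : ℕ} {δ : ℝ} (hW : AnalyticAt ℝ W 0)
    (hδ : 0 < δ) (hm1 : 1 ≤ m)
    (h0 : ∀ k < m, iteratedDeriv k W 0 = 0) (hm : iteratedDeriv m W 0 ≠ 0) :
    ∃ ε ∈ Ioo 0 δ, ∃ C > 0, ContinuousOn W (Icc 0 ε) ∧ (∀ x ∈ Icc 0 ε, W x ≤ C * x ^ m) ∧
      ∀ x ∈ Ioc 0 ε, ∀ y ∈ Ioc 0 ε, x ≤ y → W x ^ 2 * y ≤ W y ^ 2 * x := by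
  obtain ⟨u, hu, hu0, hWu⟩ := hW.exists_eq_pow_mul_of_iteratedDeriv h0 hm
  set g : ℝ → ℝ := fun x ↦ x * u x ^ 2 with hg
  have hgA : AnalyticAt ℝ g 0 := by fun_prop
  have hg' : deriv g 0 = u 0 ^ 2 := by
    have h : HasDerivAt g _ 0 :=
      (hasDerivAt_id (0 : ℝ)).mul (hu.differentiableAt.hasDerivAt.pow 2)
    simpa using h.deriv
  have hdpos : ∀ᶠ x in 𝓝 0, 0 < deriv g x :=
    hgA.deriv.continuousAt.eventually (lt_mem_nhds (by rw [hg']; positivity))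
  have hub : ∀ᶠ x in 𝓝 0, u x < |u 0| + 1 :=
    hu.continuousAt.eventually (gt_mem_nhds (by linarith [le_abs_self (u 0)]))
  obtain ⟨r, hr, hball⟩ := Metric.eventually_nhds_iff.1
    ((((hWu.and hdpos).and hub).and hW.eventually_analyticAt).and hgA.eventually_analyticAt)
  have hε : 0 < min (r / 2) (δ / 2) := by positivity
  set ε := min (r / 2) (δ / 2)
  have hεr : ε ≤ r / 2 := min_le_left _ _
  have hεδ : ε ≤ δ / 2 := min_le_right _ _
  have key : ∀ x ∈ Icc 0 ε, ((((W x = x ^ m * u x ∧ 0 < deriv g x) ∧ u x < |u 0| + 1) ∧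
      AnalyticAt ℝ W x) ∧ AnalyticAt ℝ g x) := fun x hx ↦ hball (by
    rw [Real.dist_eq, sub_zero, abs_of_nonneg hx.1]; linarith [hx.2])
  have hmono : MonotoneOn g (Icc 0 ε) := by
    refine monotoneOn_of_deriv_nonneg (convex_Icc _ _)
      (fun x hx ↦ (key x hx).2.continuousAt.continuousWithinAt)
      (fun x hx ↦ (key x (interior_subset hx)).2.differentiableAt.differentiableWithinAt)
      (fun x hx ↦ (key x (interior_subset hx)).1.1.1.2.le)
  refine ⟨ε, ⟨hε, by linarith⟩, |u 0| + 1, by positivity,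
    fun x hx ↦ (key x hx).1.2.continuousAt.continuousWithinAt, fun x hx ↦ ?_, ?_⟩
  · obtain ⟨⟨⟨⟨hx1, -⟩, hx2⟩, -⟩, -⟩ := key x hx
    rw [hx1, mul_comm]
    exact mul_le_mul_of_nonneg_right hx2.le (pow_nonneg hx.1 _)
  · intro x hx y hy hxy
    have hgxy := hmono (Ioc_subset_Icc_self hx) (Ioc_subset_Icc_self hy) hxy
    rw [(key x (Ioc_subset_Icc_self hx)).1.1.1.1, (key y (Ioc_subset_Icc_self hy)).1.1.1.1]
    obtain ⟨k, rfl⟩ : ∃ k, m = k + 1 := ⟨m - 1, by omega⟩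
    have hxk : (x ^ k) ^ 2 ≤ (y ^ k) ^ 2 := by
      have := hx.1.le
      gcongr
    have hgx : 0 ≤ g x := mul_nonneg hx.1.le (sq_nonneg _)
    have hprod := mul_le_mul hxk hgxy hgx (sq_nonneg _)
    have hxy0 : 0 ≤ x * y := mul_nonneg hx.1.le hy.1.le
    calc (x ^ (k + 1) * u x) ^ 2 * y = (x ^ k) ^ 2 * g x * (x * y) := by simp only [hg]; ring
      _ ≤ (y ^ k) ^ 2 * g y * (x * y) := mul_le_mul_of_nonneg_right hprod hxy0
      _ = (y ^ (k + 1) * u y) ^ 2 * x := by simp only [hg]; ring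

/-- The period integrand is integrable up to a turning point `b` with `W b = h` as soon as
`W ^ 2 / x ≤ h ^ 2 / b` on `(0, b]`. -/
theorem intervalIntegrable_one_div_sqrt_sub {W : ℝ → ℝ} {b h : ℝ} (hb : 0 < b) (hh : 0 < h)
    (hc : ContinuousOn W (Icc 0 b)) (hbd : ∀ x ∈ Ioo 0 b, W x ^ 2 * b ≤ h ^ 2 * x)
    (hlt : ∀ x ∈ Ioo 0 b, W x < h) :
    IntervalIntegrable (fun x ↦ 1 / √(2 * (h - W x))) volume 0 b := by
  have hdom : IntervalIntegrable (fun x : ℝ ↦ (√(h / b))⁻¹ * (b - x) ^ (-(1 / 2) : ℝ))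
      volume 0 b := by
    have h1 : IntervalIntegrable (fun x : ℝ ↦ x ^ (-(1 / 2) : ℝ)) volume b 0 :=
      intervalIntegrable_rpow' (by norm_num)
    simpa using (h1.comp_sub_left b).const_mul (√(h / b))⁻¹
  have hrestr : volume.restrict (uIoc 0 b) = volume.restrict (Ioo 0 b) := by
    rw [uIoc_of_le hb.le, restrict_Ioo_eq_restrict_Ioc]
  refine hdom.mono_fun' ?_ ?_
  · rw [hrestr]
    refine ContinuousOn.aestronglyMeasurable (fun x hx ↦ ?_) measurableSet_Ioo
    have hWx : ContinuousWithinAt W (Ioo 0 b) x :=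
      (hc x (Ioo_subset_Icc_self hx)).mono Ioo_subset_Icc_self
    refine continuousWithinAt_const.div
      (continuousWithinAt_const.mul (continuousWithinAt_const.sub hWx)).sqrt ?_
    exact (Real.sqrt_pos.2 (by linarith [hlt x hx])).ne'
  · rw [hrestr]
    refine ae_restrict_of_forall_mem measurableSet_Ioo fun x hx ↦ ?_
    have hbx : 0 < b - x := sub_pos.2 hx.2
    have hlower : h / b * (b - x) ≤ 2 * (h - W x) := by
      rw [div_mul_eq_mul_div, div_le_iff₀ hb]
      have h1 := hbd x hx
      have h2 : h * (h * (b - x)) ≤ h * (2 * (h - W x) * b) := by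
        nlinarith [mul_nonneg hb.le (sq_nonneg (h - W x))]
      exact le_of_mul_le_mul_left h2 hh
    beta_reduce
    rw [Real.norm_of_nonneg (by positivity), Real.rpow_neg hbx.le, ← Real.sqrt_eq_rpow,
      ← mul_inv, ← Real.sqrt_mul (by positivity), ← one_div]
    exact one_div_le_one_div_of_le (Real.sqrt_pos.2 (by positivity)) (Real.sqrt_le_sqrt hlower)

/-- The contribution of one side to the half period is a convergent integral for small energies,
and it diverges as the energy tends to `0` if the potential vanishes to order at least `3`. -/
theorem half_period_one_sided {W : ℝ → ℝ} {m : ℕ} {δ : ℝ} (hW : AnalyticAt ℝ W 0) (hW0 : W 0 = 0)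
    (hδ : 0 < δ) (hpos : ∀ x ∈ Ioo 0 δ, 0 < W x) (hm1 : 1 ≤ m)
    (h0 : ∀ k < m, iteratedDeriv k W 0 = 0) (hm : iteratedDeriv m W 0 ≠ 0) {b : ℝ → ℝ}
    (hb : ∀ᶠ h in 𝓝[>] (0 : ℝ), b h ∈ Ioo 0 δ ∧ W (b h) = h ∧ ∀ x ∈ Ioo 0 (b h), W x ≠ h) :
    (∀ᶠ h in 𝓝[>] (0 : ℝ),
      IntervalIntegrable (fun x ↦ 1 / √(2 * (h - W x))) volume 0 (b h)) ∧
    (3 ≤ m → Tendsto (fun h ↦ ∫ x in (0 : ℝ)..b h, 1 / √(2 * (h - W x))) (𝓝[>] 0) atTop) := by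
  obtain ⟨ε, hε, C, hC, hcont, hbound, hmono⟩ := hW.exists_right_bounds hδ hm1 h0 hm
  have hsmall : ∀ η ∈ Ioc 0 ε, ∀ᶠ h in 𝓝[>] (0 : ℝ), b h < η := by
    intro η hη
    have hη0 : 0 < W η := hpos η ⟨hη.1, hη.2.trans_lt hε.2⟩
    filter_upwards [hb, Ioo_mem_nhdsGT hη0] with h hbh hh
    have hsub : Icc 0 η ⊆ Icc 0 ε := Icc_subset_Icc_right hη.2
    obtain ⟨x, hx, hxh⟩ := intermediate_value_Ioo hη.1.le (hcont.mono hsub)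
      (show h ∈ Ioo (W 0) (W η) by rwa [hW0])
    by_contra hlt
    exact hbh.2.2 x ⟨hx.1, hx.2.trans_le (not_lt.1 hlt)⟩ hxh
  have hgood : ∀ᶠ h in 𝓝[>] (0 : ℝ), (0 < h ∧ b h ∈ Ioo 0 ε ∧ W (b h) = h) ∧
      (∀ x ∈ Ioo 0 (b h), W x < h ∧ 0 < W x) ∧
      IntervalIntegrable (fun x ↦ 1 / √(2 * (h - W x))) volume 0 (b h) := by
    filter_upwards [hb, hsmall ε ⟨hε.1, le_rfl⟩, self_mem_nhdsWithin] with h hbh hbε hh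
    have hh : 0 < h := hh
    have hWpos : ∀ x ∈ Ioo 0 (b h), 0 < W x := fun x hx ↦ hpos x ⟨hx.1, hx.2.trans hbh.1.2⟩
    have hsq : ∀ x ∈ Ioo 0 (b h), W x ^ 2 * b h ≤ h ^ 2 * x := fun x hx ↦ by
      have := hmono x ⟨hx.1, (hx.2.trans hbε).le⟩ (b h) ⟨hbh.1.1, hbε.le⟩ hx.2.le
      rwa [hbh.2.1] at this
    have hlt : ∀ x ∈ Ioo 0 (b h), W x < h := fun x hx ↦ by
      have h1 : W x ^ 2 * b h < h ^ 2 * b h :=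
        (hsq x hx).trans_lt (mul_lt_mul_of_pos_left hx.2 (by positivity))
      exact lt_of_pow_lt_pow_left₀ 2 hh.le (lt_of_mul_lt_mul_right h1 hbh.1.1.le)
    refine ⟨⟨hh, ⟨hbh.1.1, hbε⟩, hbh.2.1⟩, fun x hx ↦ ⟨hlt x hx, hWpos x hx⟩, ?_⟩
    exact intervalIntegrable_one_div_sqrt_sub hbh.1.1 hh
      (hcont.mono (Icc_subset_Icc_right hbε.le)) hsq hlt
  refine ⟨hgood.mono fun h hh ↦ hh.2.2, fun hm3 ↦ ?_⟩
  have hb0 : Tendsto b (𝓝[>] 0) (𝓝[>] 0) := by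
    refine tendsto_nhdsWithin_iff.2 ⟨?_, hgood.mono fun h hh ↦ hh.1.2.1.1⟩
    refine tendsto_order.2 ⟨fun a ha ↦ hgood.mono fun h hh ↦ ha.trans hh.1.2.1.1, fun a ha ↦ ?_⟩
    filter_upwards [hsmall (min a ε) ⟨lt_min ha hε.1, min_le_right _ _⟩] with h hh
    exact hh.trans_le (min_le_left _ _)
  have hsqrt : Tendsto (fun h ↦ (√(2 * C * b h))⁻¹) (𝓝[>] 0) atTop := by
    refine tendsto_inv_nhdsGT_zero.comp (tendsto_nhdsWithin_iff.2 ⟨?_, ?_⟩)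
    · have hlim : Tendsto (fun t : ℝ ↦ √(2 * C * t)) (𝓝 0) (𝓝 0) := by
        have : Continuous fun t : ℝ ↦ √(2 * C * t) := by fun_prop
        simpa using this.tendsto 0
      exact hlim.comp (tendsto_nhds_of_tendsto_nhdsWithin hb0)
    · filter_upwards [hgood] with h hh
      have := hh.1.2.1.1
      exact Real.sqrt_pos.2 (by positivity)
  refine tendsto_atTop_mono' _ ?_ hsqrt
  filter_upwards [hgood, hb0 (Ioo_mem_nhdsGT one_pos)] with h ⟨⟨hh, hbε, hWb⟩, hlt, hint⟩ hb1
  have hb1 : b h ∈ Ioo 0 1 := hb1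
  have hbpos : 0 < b h := hb1.1
  have hle : h ≤ C * b h ^ 3 := by
    calc h = W (b h) := hWb.symm
      _ ≤ C * b h ^ m := hbound _ ⟨hbε.1.le, hbε.2.le⟩
      _ ≤ C * b h ^ 3 :=
        mul_le_mul_of_nonneg_left (pow_le_pow_of_le_one hbpos.le hb1.2.le hm3) hC.le
  calc (√(2 * C * b h))⁻¹ = b h * (√(2 * (C * b h ^ 3)))⁻¹ := by
        rw [show 2 * (C * b h ^ 3) = 2 * C * b h * b h ^ 2 by ring,
          Real.sqrt_mul (by positivity) (b h ^ 2), Real.sqrt_sq hbpos.le, mul_inv]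
        field_simp
    _ ≤ b h * (√(2 * h))⁻¹ := by
        have : 0 < √(2 * h) := Real.sqrt_pos.2 (by positivity)
        gcongr
    _ = ∫ _ in (0 : ℝ)..b h, (√(2 * h))⁻¹ := by
        rw [intervalIntegral.integral_const, sub_zero, smul_eq_mul]
    _ ≤ ∫ x in (0 : ℝ)..b h, 1 / √(2 * (h - W x)) := by
        refine integral_mono_on_of_le_Ioo hbpos.le intervalIntegrable_const hint fun x hx ↦ ?_
        have h1 := hlt x hx
        rw [← one_div]
        exact one_div_le_one_div_of_le (Real.sqrt_pos.2 (by linarith))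
          (Real.sqrt_le_sqrt (by linarith))

/-- **Theorem B, cases (ii), (iii), (vi), (vii), (viii).** For the piecewise
potential system `ẋ = y, ẏ = -V'(x)` with `V = V⁺` on `x ≥ 0` and `V = V⁻` on
`x < 0`, where `V⁺` vanishes to order `m⁺ ≥ 1` and `V⁻` to order `m⁻ ≥ 1` at `0`,
`V > 0` on `(-δ,0) ∪ (0,δ)`, and `max(m⁺, m⁻) ≥ 3`, the period function `T(h)` is
non-constant on `(0, h₀)` for every `h₀ > 0`: the center is not isochronous. -/
theorem nonisochronous_degenerate_cases_theoremB
    (Vp Vm : ℝ → ℝ)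
    (hVpA : AnalyticAt ℝ Vp 0) (hVmA : AnalyticAt ℝ Vm 0)
    (hVp0 : Vp 0 = 0) (hVm0 : Vm 0 = 0)
    (V : ℝ → ℝ) (hV : ∀ x, V x = if 0 ≤ x then Vp x else Vm x)
    (δ : ℝ) (hδ : 0 < δ)
    (hVpos : ∀ x ∈ Ioo (-δ) δ, x ≠ 0 → 0 < V x)
    -- `V⁺` vanishes to order `m⁺ ≥ 1` at `0`, `V⁻` to order `m⁻ ≥ 1` at `0`
    (mp mm : ℕ) (hmp : 1 ≤ mp) (hmm : 1 ≤ mm)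
    (hVpOrd : (∀ k < mp, iteratedDeriv k Vp 0 = 0) ∧ iteratedDeriv mp Vp 0 ≠ 0)
    (hVmOrd : (∀ k < mm, iteratedDeriv k Vm 0 = 0) ∧ iteratedDeriv mm Vm 0 ≠ 0)
    (hmax : 3 ≤ max mp mm)
    -- the turning points `x₋(h) ∈ (-δ,0)` and `x₊(h) ∈ (0,δ)`
    (xm xp : ℝ → ℝ)
    (hxm : ∀ᶠ h in 𝓝[>] (0:ℝ), xm h ∈ Ioo (-δ) 0 ∧ V (xm h) = h ∧
      ∀ x ∈ Ioo (xm h) 0, V x ≠ h)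
    (hxp : ∀ᶠ h in 𝓝[>] (0:ℝ), xp h ∈ Ioo 0 δ ∧ V (xp h) = h ∧
      ∀ x ∈ Ioo 0 (xp h), V x ≠ h)
    -- the period function
    (T : ℝ → ℝ)
    (hT : ∀ h, T h = 2 * ∫ x in xm h..xp h, 1 / Real.sqrt (2 * (h - V x))) :
    ∀ h₀ > (0:ℝ), ∃ h₁ ∈ Ioo (0:ℝ) h₀, ∃ h₂ ∈ Ioo (0:ℝ) h₀, T h₁ ≠ T h₂ := by
  have hright := half_period_one_sided (b := xp) hVpA hVp0 hδ
    (fun x hx ↦ by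
      have := hVpos x ⟨by linarith [hx.1], hx.2⟩ hx.1.ne'
      rwa [hV, if_pos hx.1.le] at this) hmp hVpOrd.1 hVpOrd.2
    (by
      filter_upwards [hxp] with h ⟨h1, h2, h3⟩
      refine ⟨h1, by rwa [hV, if_pos h1.1.le] at h2, fun x hx ↦ ?_⟩
      have := h3 x hx
      rwa [hV, if_pos hx.1.le] at this)
  have hleft := half_period_one_sided (W := fun x ↦ Vm (-x)) (m := mm) (b := fun h ↦ -xm h)
    (AnalyticAt.fun_comp (by simpa using hVmA) analyticAt_id.neg) (by simpa using hVm0) hδ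
    (fun x hx ↦ by
      have := hVpos (-x) ⟨by linarith [hx.2], by linarith [hx.1]⟩ (by linarith [hx.1])
      rwa [hV, if_neg (by linarith [hx.1])] at this) hmm
    (fun k hk ↦ by simp [iteratedDeriv_comp_neg, hVmOrd.1 k hk])
    (by simpa [iteratedDeriv_comp_neg] using hVmOrd.2)
    (by
      filter_upwards [hxm] with h ⟨h1, h2, h3⟩
      refine ⟨⟨by linarith [h1.2], by linarith [h1.1]⟩, ?_, fun x hx ↦ ?_⟩
      · rw [hV, if_neg (by linarith [h1.2])] at h2
        simpa using h2
      · have := h3 (-x) ⟨by linarith [hx.2], by linarith [hx.1]⟩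
        rwa [hV, if_neg (by linarith [hx.1])] at this)
  have hsplit : ∀ᶠ h in 𝓝[>] (0 : ℝ),
      T h = 2 * ((∫ x in (0 : ℝ)..-xm h, 1 / √(2 * (h - Vm (-x)))) +
        ∫ x in (0 : ℝ)..xp h, 1 / √(2 * (h - Vp x))) := by
    filter_upwards [hxm, hxp, hright.1, hleft.1] with h hm hp hip him
    have hm0 : xm h < 0 := hm.1.2
    have hp0 : 0 < xp h := hp.1.1
    have him' : IntervalIntegrable (fun x ↦ 1 / √(2 * (h - Vm x))) volume (xm h) 0 := by
      have := (IntervalIntegrable.iff_comp_neg).1 him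
      simpa using this.symm
    have heqm : EqOn (fun x ↦ 1 / √(2 * (h - Vm x))) (fun x ↦ 1 / √(2 * (h - V x)))
        (uIoo (xm h) 0) := fun x hx ↦ by
      rw [uIoo_of_le hm0.le] at hx
      simp only [hV, if_neg (not_le.2 hx.2)]
    have heqp : EqOn (fun x ↦ 1 / √(2 * (h - Vp x))) (fun x ↦ 1 / √(2 * (h - V x)))
        (uIoo 0 (xp h)) := fun x hx ↦ by
      rw [uIoo_of_le hp0.le] at hx
      simp only [hV, if_pos hx.1.le]
    rw [hT, ← integral_add_adjacent_intervals (him'.congr_uIoo heqm) (hip.congr_uIoo heqp),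
      ← integral_congr_uIoo heqm, ← integral_congr_uIoo heqp,
      integral_comp_neg (fun x ↦ 1 / √(2 * (h - Vm x))), neg_neg, neg_zero]
  have hTtop : Tendsto T (𝓝[>] 0) atTop := by
    refine Tendsto.congr' (hsplit.mono fun h hh ↦ hh.symm) (Tendsto.const_mul_atTop two_pos ?_)
    rcases le_max_iff.1 hmax with h3 | h3
    · refine tendsto_atTop_mono' _ ?_ (hright.2 h3)
      filter_upwards [hxm] with h hm
      exact le_add_of_nonneg_left
        (integral_nonneg (by linarith [hm.1.2]) fun x _ ↦ by positivity)
    · refine tendsto_atTop_mono' _ ?_ (hleft.2 h3)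
      filter_upwards [hxp] with h hp
      exact le_add_of_nonneg_right (integral_nonneg hp.1.1.le fun x _ ↦ by positivity)
  intro h₀ hh₀
  obtain ⟨h₂, hlt, hmem⟩ :=
    ((hTtop.eventually_gt_atTop (T (h₀ / 2))).and (Ioo_mem_nhdsGT hh₀)).exists
  exact ⟨h₀ / 2, ⟨by linarith, by linarith⟩, h₂, hmem, hlt.ne⟩
end

section
/- Suppose V⁺ vanishes to order m⁺ ≥ 1 at 0 and V⁻ vanishes to order m⁻ ≥ 1 at 0, with V(x) > 0 for all x ∈ (−δ, 0) ∪ (0, δ), and suppose max(m⁺, m⁻) ≥ 3. Then the period function of the non-smooth center at the origin tends to infinity at the center: lim_{h→0⁺} T(h) = +∞. -/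
open Real Filter Set Topology MeasureTheory intervalIntegral

/-- Near a zero of order `m` from the right, the cofactor `g` in `f x = x ^ m * g x` is pinched
between positive constants and has small Lipschitz oscillation. -/
lemma exists_cofactor_bounds {f g : ℝ → ℝ} {m : ℕ} {δ : ℝ} (hδ : 0 < δ)
    (hg : AnalyticAt ℝ g 0) (hg0 : g 0 ≠ 0)
    (hfg : ∀ᶠ x in 𝓝[≥] (0 : ℝ), f x = x ^ m * g x) (hpos : ∀ x ∈ Ioo 0 δ, 0 < f x) :
    ∃ r a K : ℝ, 0 < r ∧ r < δ ∧ 0 < a ∧ K * r ≤ a / 2 ∧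
      (∀ x ∈ Icc 0 r, f x = x ^ m * g x) ∧ (∀ x ∈ Icc 0 r, a ≤ g x ∧ g x ≤ 4 * a) ∧
      (∀ x ∈ Icc 0 r, ∀ y ∈ Icc 0 r, |g y - g x| ≤ K * |y - x|) := by
  have hgpos : 0 < g 0 := by
    refine lt_of_le_of_ne ?_ (Ne.symm hg0)
    refine ge_of_tendsto (hg.continuousAt.tendsto.mono_left nhdsWithin_le_nhds :
      Tendsto g (𝓝[>] 0) (𝓝 (g 0))) ?_
    filter_upwards [hfg.filter_mono (nhdsWithin_mono 0 Ioi_subset_Ici_self),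
      Ioo_mem_nhdsGT hδ] with x hx hxδ
    have h := hpos x hxδ
    rw [hx] at h
    exact (pos_of_mul_pos_right h (pow_nonneg hxδ.1.le m)).le
  obtain ⟨K, t, ht, hK⟩ := (hg.contDiffAt (n := 1)).exists_lipschitzOnWith
  have hnear : ∀ᶠ x in 𝓝[≥] (0 : ℝ),
      f x = x ^ m * g x ∧ (g 0 / 2 < g x ∧ g x < 2 * g 0) ∧ x ∈ t := by
    filter_upwards [hfg, nhdsWithin_le_nhds ht, nhdsWithin_le_nhds
      (hg.continuousAt (Ioo_mem_nhds (half_lt_self hgpos) (by linarith : g 0 < 2 * g 0)))]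
      with x h1 h2 h3 using ⟨h1, h3, h2⟩
  obtain ⟨u, hu, hsub⟩ := mem_nhdsGE_iff_exists_Icc_subset.1 hnear
  have hK1 : (0 : ℝ) < K + 1 := by positivity
  set r := min u (min (δ / 2) (g 0 / 4 / (K + 1))) with hr
  have hru : r ≤ u := min_le_left _ _
  have hrK : r ≤ g 0 / 4 / (K + 1) := (min_le_right _ _).trans (min_le_right _ _)
  have hrδ : r ≤ δ / 2 := (min_le_right _ _).trans (min_le_left _ _)
  have hr0 : 0 < r := lt_min hu (lt_min (by positivity) (by positivity))
  have hmem : ∀ x ∈ Icc 0 r, f x = x ^ m * g x ∧ (g 0 / 2 < g x ∧ g x < 2 * g 0) ∧ x ∈ t :=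
    fun x hx => hsub ⟨hx.1, hx.2.trans hru⟩
  refine ⟨r, g 0 / 2, K, hr0, by linarith, by positivity, ?_, fun x hx => (hmem x hx).1,
    fun x hx => ?_, fun x hx y hy => ?_⟩
  · rw [le_div_iff₀ hK1] at hrK
    nlinarith
  · obtain ⟨-, ⟨h1, h2⟩, -⟩ := hmem x hx
    constructor <;> linarith
  · simpa [Real.dist_eq] using hK.dist_le_mul y (hmem y hy).2.2 x (hmem x hx).2.2

lemma sub_ge_of_cofactor_bounds {f g : ℝ → ℝ} {m : ℕ} (hm : 1 ≤ m) {r a K x y : ℝ} (ha : 0 < a)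
    (hKr : K * r ≤ a / 2) (hf : ∀ x ∈ Icc 0 r, f x = x ^ m * g x)
    (hga : ∀ x ∈ Icc 0 r, a ≤ g x)
    (hgK : ∀ x ∈ Icc 0 r, ∀ y ∈ Icc 0 r, |g y - g x| ≤ K * |y - x|)
    (hx : 0 ≤ x) (hxy : x ≤ y) (hy : y ≤ r) :
    y ^ (m - 1) * (a / 2) * (y - x) ≤ f y - f x := by
  obtain ⟨n, rfl⟩ : ∃ n, m = n + 1 := ⟨m - 1, by omega⟩
  have hxr : x ∈ Icc 0 r := ⟨hx, hxy.trans hy⟩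
  have hyr : y ∈ Icc 0 r := ⟨hx.trans hxy, hy⟩
  rw [hf x hxr, hf y hyr, Nat.add_sub_cancel]
  have hpow : x ^ n ≤ y ^ n := pow_le_pow_left₀ hx hxy n
  have hyn : 0 ≤ y ^ n := pow_nonneg hyr.1 n
  have hd : 0 ≤ y - x := sub_nonneg.2 hxy
  have hosc : -(a / 2) * (y - x) ≤ x * (g y - g x) := by
    have h1 := (abs_le.1 (hgK x hxr y hyr)).1
    rw [abs_of_nonneg hd] at h1
    rcases le_total 0 K with hK | hK
    · nlinarith [mul_le_mul_of_nonneg_left h1 hx,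
        mul_le_mul_of_nonneg_right (mul_le_mul_of_nonneg_left hxr.2 hK) hd,
        mul_le_mul_of_nonneg_right hKr hd]
    · nlinarith [mul_le_mul_of_nonneg_left h1 hx,
        mul_nonneg (mul_nonneg hx hd) (neg_nonneg.2 hK), mul_nonneg ha.le hd]
  have h1 : x ^ n * (-(a / 2) * (y - x)) ≤ x ^ n * (x * (g y - g x)) :=
    mul_le_mul_of_nonneg_left hosc (pow_nonneg hx n)
  have h2 : x ^ n * ((a / 2) * (y - x)) ≤ y ^ n * ((a / 2) * (y - x)) :=
    mul_le_mul_of_nonneg_right hpow (by positivity)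
  have h3 : (y ^ n * (y - x)) * a ≤ (y ^ (n + 1) - x ^ (n + 1)) * g y := by
    have h4 : y ^ n * (y - x) ≤ y ^ (n + 1) - x ^ (n + 1) := by
      rw [pow_succ, pow_succ]
      nlinarith [mul_le_mul_of_nonneg_right hpow hx]
    exact mul_le_mul h4 (hga y hyr) ha.le ((by positivity : 0 ≤ y ^ n * (y - x)).trans h4)
  have h5 : x ^ (n + 1) * g y = x ^ n * (x * g y) := by ring
  have h6 : x ^ (n + 1) * g x = x ^ n * (x * g x) := by ring
  nlinarith

/-- If `f y - f x` grows at least linearly in `y - x` on `[0, y]`, then the time integrand has an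
integrable singularity at the turning point `y`. -/
lemma intervalIntegrable_one_div_sqrt {f : ℝ → ℝ} {c y : ℝ} (hc : 0 < c) (hy : 0 ≤ y)
    (hf : ContinuousOn f (Icc 0 y)) (hlow : ∀ x ∈ Icc 0 y, c * (y - x) ≤ f y - f x) :
    IntervalIntegrable (fun x => 1 / √(2 * (f y - f x))) volume 0 y := by
  have hdom : IntervalIntegrable (fun x : ℝ => 1 / √(2 * c) * (y - x) ^ (-(1 / 2) : ℝ))
      volume 0 y := by
    have h := ((intervalIntegrable_rpow' (a := 0) (b := y)
      (by norm_num : (-1 : ℝ) < -(1 / 2))).comp_sub_left y).symm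
    simp only [sub_self, sub_zero] at h
    exact h.const_mul _
  refine hdom.mono_fun' ?_ ?_
  · have hfm : AEMeasurable f (volume.restrict (uIoc 0 y)) := by
      rw [uIoc_of_le hy]
      exact (hf.mono Ioc_subset_Icc_self).aemeasurable measurableSet_Ioc
    have h2 : AEMeasurable (fun x => 2 * (f y - f x)) (volume.restrict (uIoc 0 y)) :=
      (aemeasurable_const.sub hfm).const_mul 2
    exact ((measurable_const.div Real.continuous_sqrt.measurable).comp_aemeasurable
      h2).aestronglyMeasurable
  · rw [uIoc_of_le hy]
    refine (ae_restrict_iff' measurableSet_Ioc).2 (ae_of_all _ fun x hx => ?_)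
    rcases hx.2.eq_or_lt with rfl | hxy
    · simp only [sub_self, mul_zero, Real.sqrt_zero, div_zero, norm_zero]
      positivity
    · have hd : 0 < y - x := sub_pos.2 hxy
      have h := hlow x ⟨hx.1.le, hx.2⟩
      have hprod : 1 / √(2 * c) * (y - x) ^ (-(1 / 2) : ℝ) = 1 / √(2 * c * (y - x)) := by
        rw [Real.rpow_neg hd.le, ← Real.sqrt_eq_rpow, Real.sqrt_mul (by positivity) (y - x)]
        ring
      simp only [hprod]
      rw [Real.norm_of_nonneg (by positivity)]
      refine one_div_le_one_div_of_le (Real.sqrt_pos.2 (by positivity)) (Real.sqrt_le_sqrt ?_)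
      nlinarith

/-- The first point at height `h` to the right of `0` tends to `0` with `h`. -/
lemma eventually_turningPoint_le {f y : ℝ → ℝ} {r : ℝ} (hr : 0 < r)
    (hf : ContinuousOn f (Icc 0 r)) (hf0 : f 0 = 0) (hfr : 0 < f r)
    (hy : ∀ᶠ h in 𝓝[>] (0 : ℝ), ∀ x ∈ Ioo 0 (y h), f x ≠ h) :
    ∀ᶠ h in 𝓝[>] (0 : ℝ), y h ≤ r := by
  filter_upwards [hy, Ioo_mem_nhdsGT hfr] with h hh hhr
  obtain ⟨x, hx, hfx⟩ := intermediate_value_Ioo hr.le hf (by rwa [hf0])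
  by_contra! hlt
  exact hh x ⟨hx.1, hx.2.trans hlt⟩ hfx

/-- Behaviour of the time spent on one side of a non-smooth center: the integral converges for
small energies, and it is unbounded if the potential vanishes to order at least three. -/
lemma oneSided_period {f g y : ℝ → ℝ} {m : ℕ} {δ : ℝ} (hm : 1 ≤ m) (hδ : 0 < δ)
    (hg : AnalyticAt ℝ g 0) (hg0 : g 0 ≠ 0)
    (hfg : ∀ᶠ x in 𝓝[≥] (0 : ℝ), f x = x ^ m * g x) (hpos : ∀ x ∈ Ioo 0 δ, 0 < f x)
    (hy : ∀ᶠ h in 𝓝[>] (0 : ℝ), y h ∈ Ioo 0 δ ∧ f (y h) = h ∧ ∀ x ∈ Ioo 0 (y h), f x ≠ h) :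
    (∀ᶠ h in 𝓝[>] (0 : ℝ), IntervalIntegrable (fun x => 1 / √(2 * (h - f x))) volume 0 (y h)) ∧
    (∀ᶠ h in 𝓝[>] (0 : ℝ), 0 ≤ ∫ x in 0..y h, 1 / √(2 * (h - f x))) ∧
    (3 ≤ m → Tendsto (fun h => ∫ x in 0..y h, 1 / √(2 * (h - f x))) (𝓝[>] (0 : ℝ)) atTop) := by
  obtain ⟨r, a, K, hr, hrδ, ha, hKr, hf, hga, hgK⟩ := exists_cofactor_bounds hδ hg hg0 hfg hpos
  have hf0 : f 0 = 0 := by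
    rw [hf 0 ⟨le_rfl, hr.le⟩, zero_pow (by omega), zero_mul]
  have hgc : ContinuousOn g (Icc 0 r) := by
    refine (LipschitzOnWith.of_dist_le' (K := K) fun x hx y hy => ?_).continuousOn
    simpa [Real.dist_eq] using hgK y hy x hx
  have hfc : ContinuousOn f (Icc 0 r) :=
    ((continuous_pow m).continuousOn.mul hgc).congr hf
  have hsmall : ∀ s, 0 < s → s ≤ r → ∀ᶠ h in 𝓝[>] (0 : ℝ), y h ≤ s := fun s hs hsr =>
    eventually_turningPoint_le hs (hfc.mono (Icc_subset_Icc_right hsr)) hf0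
      (hpos s ⟨hs, hsr.trans_lt hrδ⟩) (hy.mono fun h hh => hh.2.2)
  have hlow {x z : ℝ} (hx : 0 ≤ x) (hxz : x ≤ z) (hz : z ≤ r) :=
    sub_ge_of_cofactor_bounds hm ha hKr hf (fun x hx => (hga x hx).1) hgK hx hxz hz
  have hint : ∀ᶠ h in 𝓝[>] (0 : ℝ),
      IntervalIntegrable (fun x => 1 / √(2 * (h - f x))) volume 0 (y h) := by
    filter_upwards [hy, hsmall r hr le_rfl] with h hh hyr
    have h0 := hh.1.1
    have := intervalIntegrable_one_div_sqrt (f := f) (c := y h ^ (m - 1) * (a / 2))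
      (by positivity) h0.le (hfc.mono (Icc_subset_Icc_right hyr))
      fun x hx => hlow hx.1 hx.2 hyr
    rwa [hh.2.1] at this
  refine ⟨hint, ?_, fun hm3 => ?_⟩
  · filter_upwards [hy] with h hh
    exact intervalIntegral.integral_nonneg hh.1.1.le fun x _ => by positivity
  · refine tendsto_atTop.2 fun M => ?_
    set s := min r (min 1 (1 / (8 * a * (M ^ 2 + 1)))) with hs
    have hs0 : 0 < s := lt_min hr (lt_min one_pos (by positivity))
    filter_upwards [hy, hint, hsmall s hs0 (min_le_left _ _)] with h hh hi hys
    obtain ⟨⟨h0, -⟩, hfy, -⟩ := hh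
    have hyr : y h ≤ r := hys.trans (min_le_left _ _)
    have hy1 : y h ≤ 1 := hys.trans ((min_le_right _ _).trans (min_le_left _ _))
    have hyM : y h ≤ 1 / (8 * a * (M ^ 2 + 1)) :=
      hys.trans ((min_le_right _ _).trans (min_le_right _ _))
    have hbound : h ≤ 4 * a * y h ^ 3 := by
      have hyy : y h ∈ Icc 0 r := ⟨h0.le, hyr⟩
      have h3 : y h ^ m ≤ y h ^ 3 := pow_le_pow_of_le_one h0.le hy1 hm3
      calc h = y h ^ m * g (y h) := by rw [← hf _ hyy, hfy]
        _ ≤ y h ^ 3 * (4 * a) := mul_le_mul h3 (hga _ hyy).2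
            (ha.le.trans (hga _ hyy).1) (by positivity)
        _ = _ := by ring
    have hle : ∫ _ in 0..y h, 1 / √(8 * a * y h ^ 3) ≤
        ∫ x in 0..y h, 1 / √(2 * (h - f x)) := by
      refine integral_mono_on_of_le_Ioo h0.le (by simp) hi fun x hx => ?_
      have hlt : 0 < h - f x := by
        have := hlow hx.1.le hx.2.le hyr
        rw [hfy] at this
        have hd := sub_pos.2 hx.2
        exact lt_of_lt_of_le (by positivity) this
      have hfx : 0 < f x := hpos x ⟨hx.1, (hx.2.trans_le hyr).trans hrδ⟩
      refine one_div_le_one_div_of_le (Real.sqrt_pos.2 (by positivity)) (Real.sqrt_le_sqrt ?_)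
      nlinarith
    refine le_trans ?_ hle
    rw [intervalIntegral.integral_const, sub_zero, smul_eq_mul, mul_one_div, le_div_iff₀ (by positivity)]
    rw [le_div_iff₀ (by positivity)] at hyM
    refine le_of_abs_le (abs_le_of_sq_le_sq ?_ h0.le)
    rw [mul_pow, Real.sq_sqrt (by positivity)]
    nlinarith [mul_le_mul_of_nonneg_left hyM (sq_nonneg (y h)), pow_pos h0 3]

/-- For the piecewise potential system `ẋ = y, ẏ = -V'(x)` with `V = V⁺` on
`x ≥ 0` and `V = V⁻` on `x < 0`, where `V⁺` vanishes to order `m⁺ ≥ 1` and `V⁻`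
to order `m⁻ ≥ 1` at `0`, `V > 0` on `(-δ,0) ∪ (0,δ)`, and `max(m⁺, m⁻) ≥ 3`,
the period function tends to infinity at the center: `lim_{h→0⁺} T(h) = +∞`. -/
theorem period_tends_to_infinity_degenerate_cases
    (Vp Vm : ℝ → ℝ)
    (hVpA : AnalyticAt ℝ Vp 0) (hVmA : AnalyticAt ℝ Vm 0)
    (hVp0 : Vp 0 = 0) (hVm0 : Vm 0 = 0)
    (V : ℝ → ℝ) (hV : ∀ x, V x = if 0 ≤ x then Vp x else Vm x)
    (δ : ℝ) (hδ : 0 < δ)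
    (hVpos : ∀ x ∈ Ioo (-δ) δ, x ≠ 0 → 0 < V x)
    -- `V⁺` vanishes to order `m⁺ ≥ 1` at `0`, `V⁻` to order `m⁻ ≥ 1` at `0`
    (mp mm : ℕ) (hmp : 1 ≤ mp) (hmm : 1 ≤ mm)
    (hVpOrd : (∀ k < mp, iteratedDeriv k Vp 0 = 0) ∧ iteratedDeriv mp Vp 0 ≠ 0)
    (hVmOrd : (∀ k < mm, iteratedDeriv k Vm 0 = 0) ∧ iteratedDeriv mm Vm 0 ≠ 0)
    (hmax : 3 ≤ max mp mm)
    -- the turning points `x₋(h) ∈ (-δ,0)` and `x₊(h) ∈ (0,δ)`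
    (xm xp : ℝ → ℝ)
    (hxm : ∀ᶠ h in 𝓝[>] (0:ℝ), xm h ∈ Ioo (-δ) 0 ∧ V (xm h) = h ∧
      ∀ x ∈ Ioo (xm h) 0, V x ≠ h)
    (hxp : ∀ᶠ h in 𝓝[>] (0:ℝ), xp h ∈ Ioo 0 δ ∧ V (xp h) = h ∧
      ∀ x ∈ Ioo 0 (xp h), V x ≠ h)
    -- the period function
    (T : ℝ → ℝ)
    (hT : ∀ h, T h = 2 * ∫ x in xm h..xp h, 1 / Real.sqrt (2 * (h - V x))) :
    Tendsto T (𝓝[>] (0:ℝ)) atTop := by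
  obtain ⟨gp, hgpA, hgp0, hgp⟩ := hVpA.analyticOrderAt_eq_natCast.1
    ((analyticOrderAt_eq_nat_iff_iteratedDeriv_eq_zero hVpA).2 hVpOrd)
  obtain ⟨gm, hgmA, hgm0, hgm⟩ := hVmA.analyticOrderAt_eq_natCast.1
    ((analyticOrderAt_eq_nat_iff_iteratedDeriv_eq_zero hVmA).2 hVmOrd)
  have hneg : Tendsto (fun x : ℝ => -x) (𝓝 0) (𝓝 0) := by
    simpa using (continuous_neg (G := ℝ)).tendsto 0
  have hgmA' : AnalyticAt ℝ (fun x => (-1) ^ mm * gm (-x)) 0 :=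
    analyticAt_const.mul (AnalyticAt.fun_comp (by simpa using hgmA) analyticAt_id.neg)
  obtain ⟨hpi, hpn, hpt⟩ := oneSided_period hmp hδ hgpA hgp0
    (f := V) (y := xp) (by
      filter_upwards [nhdsWithin_le_nhds hgp, self_mem_nhdsWithin] with x hx hx0
      rw [hV, if_pos (mem_Ici.1 hx0), hx, sub_zero, smul_eq_mul])
    (fun x hx => hVpos x ⟨by linarith [hx.1], hx.2⟩ hx.1.ne') hxp
  obtain ⟨hmi, hmn, hmt⟩ := oneSided_period hmm hδ hgmA' (by simpa using hgm0)
    (f := fun x => V (-x)) (y := fun h => -xm h) (by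
      filter_upwards [nhdsWithin_le_nhds (hneg.eventually hgm), self_mem_nhdsWithin]
        with x hx hx0
      rcases (mem_Ici.1 hx0).eq_or_lt with rfl | hx0
      · simp [hV, hVp0, zero_pow (by omega : mm ≠ 0)]
      · rw [hV, if_neg (by linarith), hx, sub_zero, smul_eq_mul, neg_pow]
        ring)
    (fun x hx => hVpos (-x) ⟨by linarith [hx.2], by linarith [hx.1]⟩ (neg_ne_zero.2 hx.1.ne'))
    (by
      filter_upwards [hxm] with h hh
      refine ⟨⟨by linarith [hh.1.2], by linarith [hh.1.1]⟩, by simpa using hh.2.1,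
        fun x hx => hh.2.2 (-x) ⟨by linarith [hx.2], by linarith [hx.1]⟩⟩)
  have hsplit : ∀ᶠ h in 𝓝[>] (0 : ℝ),
      2 * ((∫ x in 0..-xm h, 1 / √(2 * (h - V (-x)))) +
        ∫ x in 0..xp h, 1 / √(2 * (h - V x))) = T h := by
    filter_upwards [hpi, hmi] with h hp hm
    have hm' : IntervalIntegrable (fun x => 1 / √(2 * (h - V x))) volume (xm h) 0 := by
      rw [IntervalIntegrable.iff_comp_neg, neg_zero]
      exact hm.symm
    rw [hT, ← integral_add_adjacent_intervals hm' hp,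
      integral_comp_neg (fun x => 1 / √(2 * (h - V x))), neg_neg, neg_zero]
  refine Tendsto.congr' hsplit (Tendsto.const_mul_atTop two_pos ?_)
  rcases le_max_iff.1 hmax with h3 | h3
  · exact Tendsto.zero_eventuallyLE_add_atTop hmn (hpt h3)
  · exact Tendsto.atTop_add_zero_eventuallyLE (hmt h3) hpn
end

section
/- Suppose (V⁻)′(0) < 0 and (V⁺)′(0) > 0 (so the origin is an invisible fold-fold point of the piecewise system). Then the period function T(h) of the non-smooth center at the origin is non-constant on (0, h₀) for every h₀ > 0; that is, the center is not isochronous. (Case (iv) of Theorem B.) -/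
open Real Filter Set Topology MeasureTheory intervalIntegral

/-- A function analytic at `0` with positive derivative there is continuous and expands distances
at a definite rate on some interval `[0, η]`. -/
theorem exists_rate_of_analyticAt_of_deriv_pos {f : ℝ → ℝ} (hf : AnalyticAt ℝ f 0)
    (hd : 0 < deriv f 0) :
    ∃ a > 0, ∃ η > 0, ContinuousOn f (Icc 0 η) ∧
      ∀ x y, 0 ≤ x → x ≤ y → y ≤ η → a * (y - x) ≤ f y - f x := by
  have hs := hf.hasStrictDerivAt.isLittleO.def (half_pos hd)
  have hc := hf.eventually_continuousAt
  obtain ⟨ε₁, hε₁, hs⟩ := Metric.eventually_nhds_iff.1 hs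
  obtain ⟨ε₂, hε₂, hc⟩ := Metric.eventually_nhds_iff.1 hc
  obtain ⟨η, hη, hηε⟩ := exists_between (lt_min hε₁ hε₂)
  have hdist : ∀ z, 0 ≤ z → z ≤ η → dist z 0 < min ε₁ ε₂ := fun z h0 h1 => by
    rw [Real.dist_eq, sub_zero, abs_of_nonneg h0]
    exact h1.trans_lt hηε
  refine ⟨deriv f 0 / 2, half_pos hd, η, hη, fun x hx => ?_, fun x y hx hxy hy => ?_⟩
  · exact (hc ((hdist x hx.1 hx.2).trans_le (min_le_right _ _))).continuousWithinAt
  · have := hs (y := (y, x)) (max_lt ((hdist y (hx.trans hxy) hy).trans_le (min_le_left _ _))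
      ((hdist x hx (hxy.trans hy)).trans_le (min_le_left _ _)))
    simp only [ContinuousLinearMap.toSpanSingleton_apply, smul_eq_mul, Real.norm_eq_abs,
      abs_of_nonneg (sub_nonneg.2 hxy)] at this
    linarith [neg_le_of_abs_le this]

/-- The half-period of a potential growing at rate at least `a` on `[0, p]` is a
convergent positive integral, bounded by a multiple of `√p`. -/
theorem half_period_bounds {f : ℝ → ℝ} {a p : ℝ} (ha : 0 < a) (hp : 0 < p)
    (hc : ContinuousOn f (Icc 0 p))
    (hf : ∀ x y, 0 ≤ x → x ≤ y → y ≤ p → a * (y - x) ≤ f y - f x) :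
    IntervalIntegrable (fun x => 1 / √(2 * (f p - f x))) volume 0 p ∧
      0 < ∫ x in (0:ℝ)..p, 1 / √(2 * (f p - f x)) ∧
      ∫ x in (0:ℝ)..p, 1 / √(2 * (f p - f x)) ≤ 1 / √(2 * a) * (2 * √p) := by
  have hpos : ∀ x ∈ Ioo 0 p, 0 < f p - f x := fun x hx =>
    (mul_pos ha (sub_pos.2 hx.2)).trans_le (hf x p hx.1.le hx.2.le le_rfl)
  have hle : ∀ x ∈ Ioo 0 p,
      1 / √(2 * (f p - f x)) ≤ 1 / √(2 * a) * (p - x) ^ (-(1 / 2) : ℝ) := by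
    intro x hx
    have hx' := sub_pos.2 hx.2
    rw [Real.rpow_neg hx'.le, ← Real.sqrt_eq_rpow, ← one_div, one_div_mul_one_div,
      ← Real.sqrt_mul (by positivity)]
    refine one_div_le_one_div_of_le (Real.sqrt_pos.2 (by positivity)) (Real.sqrt_le_sqrt ?_)
    nlinarith [hf x p hx.1.le hx.2.le le_rfl]
  have hgi : IntervalIntegrable (fun x => 1 / √(2 * a) * (p - x) ^ (-(1 / 2) : ℝ)) volume 0 p := by
    have := (intervalIntegrable_rpow' (a := p) (b := 0) (r := -(1 / 2)) (by norm_num)).comp_sub_left p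
    simpa using this.const_mul _
  have hgv : ∫ x in (0:ℝ)..p, 1 / √(2 * a) * (p - x) ^ (-(1 / 2) : ℝ) =
      1 / √(2 * a) * (2 * √p) := by
    rw [intervalIntegral.integral_const_mul,
      intervalIntegral.integral_comp_sub_left (fun x => x ^ (-(1 / 2) : ℝ)),
      integral_rpow (Or.inl (by norm_num)), Real.sqrt_eq_rpow p,
      sub_self, sub_zero, Real.zero_rpow (by norm_num),
      show -(1 / 2) + 1 = (1 / 2 : ℝ) by norm_num]
    ring
  have hfi : IntervalIntegrable (fun x => 1 / √(2 * (f p - f x))) volume 0 p := by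
    rw [intervalIntegrable_iff_integrableOn_Ioo_of_le hp.le] at hgi ⊢
    refine hgi.mono' ?_ ?_
    · refine ContinuousOn.aestronglyMeasurable ?_ measurableSet_Ioo
      refine continuousOn_const.div (Real.continuous_sqrt.comp_continuousOn
        (continuousOn_const.mul (continuousOn_const.sub (hc.mono Ioo_subset_Icc_self)))) ?_
      intro x hx
      have := hpos x hx
      positivity
    · refine (ae_restrict_iff' measurableSet_Ioo).2 (Eventually.of_forall fun x hx => ?_)
      rw [Real.norm_of_nonneg (by positivity)]
      exact hle x hx
  refine ⟨hfi, intervalIntegral_pos_of_pos_on hfi (fun x hx => ?_) hp, ?_⟩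
  · have := hpos x hx
    positivity
  · rw [← hgv]
    exact integral_mono_on_of_le_Ioo hp.le hfi hgi hle

/-- The half-period over the side `x ≥ 0`, on which the potential has positive slope at the origin,
is given by a convergent positive integral which tends to `0` with the energy. -/
theorem half_period_eventually {f p : ℝ → ℝ} (hf : AnalyticAt ℝ f 0) (hf0 : f 0 = 0)
    (hd : 0 < deriv f 0)
    (hp : ∀ᶠ h in 𝓝[>] (0:ℝ), 0 < p h ∧ f (p h) = h ∧ ∀ x ∈ Ioo 0 (p h), f x ≠ h) :
    (∀ᶠ h in 𝓝[>] (0:ℝ),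
      IntervalIntegrable (fun x => 1 / √(2 * (h - f x))) volume 0 (p h) ∧
        0 < ∫ x in (0:ℝ)..p h, 1 / √(2 * (h - f x))) ∧
      Tendsto (fun h => ∫ x in (0:ℝ)..p h, 1 / √(2 * (h - f x))) (𝓝[>] 0) (𝓝 0) := by
  obtain ⟨a, ha, η, hη, hc, hr⟩ := exists_rate_of_analyticAt_of_deriv_pos hf hd
  have hfη : 0 < f η := by
    have := hr 0 η le_rfl hη.le le_rfl
    have := mul_pos ha hη
    rw [hf0] at *
    linarith
  have key : ∀ᶠ h in 𝓝[>] (0:ℝ),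
      (IntervalIntegrable (fun x => 1 / √(2 * (h - f x))) volume 0 (p h) ∧
        0 < ∫ x in (0:ℝ)..p h, 1 / √(2 * (h - f x))) ∧
      ∫ x in (0:ℝ)..p h, 1 / √(2 * (h - f x)) ≤ 1 / √(2 * a) * (2 * √(h / a)) := by
    filter_upwards [hp, Ioo_mem_nhdsGT hfη] with h ⟨hp0, hph, hpn⟩ hh
    have hpη : p h ≤ η := by
      obtain ⟨x, hx, hxh⟩ := intermediate_value_Ioo hη.le hc (by rwa [hf0] : h ∈ Ioo (f 0) (f η))
      by_contra! hlt
      exact hpn x ⟨hx.1, hx.2.trans hlt⟩ hxh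
    obtain ⟨h1, h2, h3⟩ := half_period_bounds ha hp0 (hc.mono (Icc_subset_Icc_right hpη))
      (fun x y hx hxy hy => hr x y hx hxy (hy.trans hpη))
    rw [hph] at h1 h2 h3
    refine ⟨⟨h1, h2⟩, h3.trans ?_⟩
    have : p h ≤ h / a := by
      rw [le_div_iff₀ ha]
      have := hr 0 (p h) le_rfl hp0.le hpη
      rw [hf0, hph] at this
      linarith
    gcongr
  refine ⟨key.mono fun h hh => hh.1, ?_⟩
  have hlim : Tendsto (fun h : ℝ => 1 / √(2 * a) * (2 * √(h / a))) (𝓝[>] 0) (𝓝 0) := by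
    have : Continuous fun h : ℝ => 1 / √(2 * a) * (2 * √(h / a)) := by fun_prop
    simpa using (this.tendsto 0).mono_left nhdsWithin_le_nhds
  exact squeeze_zero' (key.mono fun h hh => hh.1.2.le) (key.mono fun h hh => hh.2) hlim

/-- **Theorem B, case (iv).** For the piecewise potential system
`ẋ = y, ẏ = -V'(x)` with `V = V⁺` on `x ≥ 0` and `V = V⁻` on `x < 0`, where
`(V⁻)'(0) < 0` and `(V⁺)'(0) > 0` (an invisible fold-fold point at the origin),
the period function `T(h)` is non-constant on `(0, h₀)` for every `h₀ > 0`: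
the center is not isochronous. -/
theorem nonisochronous_foldfold_case_iv
    (Vp Vm : ℝ → ℝ)
    (hVpA : AnalyticAt ℝ Vp 0) (hVmA : AnalyticAt ℝ Vm 0)
    (hVp0 : Vp 0 = 0) (hVm0 : Vm 0 = 0)
    (V : ℝ → ℝ) (hV : ∀ x, V x = if 0 ≤ x then Vp x else Vm x)
    (δ : ℝ) (hδ : 0 < δ)
    (hVpos : ∀ x ∈ Ioo (-δ) δ, x ≠ 0 → 0 < V x)
    (hVm1 : deriv Vm 0 < 0) (hVp1 : 0 < deriv Vp 0)
    -- the turning points `x₋(h) ∈ (-δ,0)` and `x₊(h) ∈ (0,δ)`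
    (xm xp : ℝ → ℝ)
    (hxm : ∀ᶠ h in 𝓝[>] (0:ℝ), xm h ∈ Ioo (-δ) 0 ∧ V (xm h) = h ∧
      ∀ x ∈ Ioo (xm h) 0, V x ≠ h)
    (hxp : ∀ᶠ h in 𝓝[>] (0:ℝ), xp h ∈ Ioo 0 δ ∧ V (xp h) = h ∧
      ∀ x ∈ Ioo 0 (xp h), V x ≠ h)
    -- the period function
    (T : ℝ → ℝ)
    (hT : ∀ h, T h = 2 * ∫ x in xm h..xp h, 1 / Real.sqrt (2 * (h - V x))) :
    ∀ h₀ > (0:ℝ), ∃ h₁ ∈ Ioo (0:ℝ) h₀, ∃ h₂ ∈ Ioo (0:ℝ) h₀, T h₁ ≠ T h₂ := by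
  have hVnn : ∀ x, 0 ≤ x → V x = Vp x := fun x hx => by rw [hV, if_pos hx]
  have hVneg : ∀ x, 0 ≤ x → V (-x) = Vm (-x) := fun x hx => by
    rcases hx.eq_or_lt with rfl | hx
    · rw [neg_zero, hVnn 0 le_rfl, hVp0, hVm0]
    · rw [hV, if_neg (by linarith)]
  have hVmA' : AnalyticAt ℝ (fun x => Vm (-x)) 0 := by
    have h : AnalyticAt ℝ Vm (-0) := by rwa [neg_zero]
    exact h.comp analyticAt_id.neg
  obtain ⟨hp, hp_lim⟩ := half_period_eventually (p := xp) hVpA hVp0 hVp1 <|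
    hxp.mono fun h ⟨h1, h2, h3⟩ => ⟨h1.1, by rw [← hVnn _ h1.1.le, h2],
      fun x hx => by rw [← hVnn _ hx.1.le]; exact h3 x hx⟩
  obtain ⟨hm, hm_lim⟩ := half_period_eventually (f := fun x => Vm (-x)) (p := fun h => -xm h)
    hVmA' (by simpa using hVm0) (by rw [deriv_comp_neg, neg_zero]; linarith) <|
    hxm.mono fun h ⟨h1, h2, h3⟩ => ⟨by linarith [h1.2],
      by rw [← hVneg _ (by linarith [h1.2]), neg_neg, h2],
      fun x hx => by
        rw [← hVneg _ hx.1.le]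
        exact h3 (-x) ⟨by linarith [hx.2], by linarith [hx.1]⟩⟩
  have hTsum : ∀ᶠ h in 𝓝[>] (0:ℝ), T h =
      2 * ((∫ x in (0:ℝ)..-xm h, 1 / √(2 * (h - Vm (-x)))) +
        ∫ x in (0:ℝ)..xp h, 1 / √(2 * (h - Vp x))) := by
    filter_upwards [hxp, hxm, hp, hm] with h hxp hxm hp hm
    have hmn : 0 ≤ -xm h := by linarith [hxm.1.2]
    have ep : EqOn (fun x => 1 / √(2 * (h - Vp x))) (fun x => 1 / √(2 * (h - V x)))
        (uIcc 0 (xp h)) := fun x hx => by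
      rw [uIcc_of_le hxp.1.1.le] at hx
      simp only [hVnn x hx.1]
    have em : EqOn (fun x => 1 / √(2 * (h - Vm (-x)))) (fun x => 1 / √(2 * (h - V (-x))))
        (uIcc 0 (-xm h)) := fun x hx => by
      rw [uIcc_of_le hmn] at hx
      simp only [hVneg x hx.1]
    have ip := hp.1.congr (ep.mono uIoc_subset_uIcc)
    have im := hm.1.congr (em.mono uIoc_subset_uIcc)
    have im' : IntervalIntegrable (fun x => 1 / √(2 * (h - V x))) volume (xm h) 0 := by
      have := ((IntervalIntegrable.iff_comp_neg enorm_ne_top).1 im).symm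
      simpa using this
    rw [hT, integral_congr ep, integral_congr em,
      integral_comp_neg (fun x => 1 / √(2 * (h - V x))), neg_neg, neg_zero,
      integral_add_adjacent_intervals im' ip]
  have hTlim : Tendsto T (𝓝[>] 0) (𝓝 0) := by
    have := (hm_lim.add hp_lim).const_mul 2
    rw [add_zero, mul_zero] at this
    exact this.congr' (hTsum.mono fun h hh => hh.symm)
  have hTpos : ∀ᶠ h in 𝓝[>] (0:ℝ), 0 < T h := by
    filter_upwards [hTsum, hp, hm] with h hh hp hm
    rw [hh]
    exact mul_pos two_pos (add_pos hm.2 hp.2)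
  intro h₀ hh₀
  obtain ⟨h₁, hT₁, hh₁⟩ := (hTpos.and (Ioo_mem_nhdsGT hh₀)).exists
  obtain ⟨h₂, hT₂, hh₂⟩ := ((hTlim.eventually_lt_const hT₁).and (Ioo_mem_nhdsGT hh₀)).exists
  exact ⟨h₁, hh₁, h₂, hh₂, hT₂.ne'⟩
end

section
/- Let ω > 0, h > 0 and n ∈ ℕ. The improper integral ∫_{−√h/ω}^{√h/ω} zⁿ/√(2(h − ω²z²)) dz converges; it equals 0 when n is odd, and when n = 2i it equals √π · Γ(i + 1/2) · hⁱ / (√2 · ω^{2i+1} · Γ(i + 1)), where Γ is the Gamma function. In particular, for n = 0 the integral equals π/(√2 ω). -/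
open Real Filter Set Topology MeasureTheory intervalIntegral

theorem integral_cos_pow_add_two_zero_pi (n : ℕ) :
    ∫ x in (0 : ℝ)..π, cos x ^ (n + 2) = (n + 1) / (n + 2) * ∫ x in (0 : ℝ)..π, cos x ^ n := by
  simp [integral_cos_pow]

theorem integral_cos_pow_zero_pi_of_odd {n : ℕ} (hn : Odd n) :
    ∫ x in (0 : ℝ)..π, cos x ^ n = 0 := by
  obtain ⟨k, rfl⟩ := hn
  induction k with
  | zero => simp
  | succ k ih =>
    rw [show 2 * (k + 1) + 1 = (2 * k + 1) + 2 by ring, integral_cos_pow_add_two_zero_pi, ih,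
      mul_zero]

theorem integral_cos_pow_two_mul_zero_pi (i : ℕ) :
    ∫ x in (0 : ℝ)..π, cos x ^ (2 * i) =
      √π * Real.Gamma ((i : ℝ) + 1 / 2) / Real.Gamma ((i : ℝ) + 1) := by
  induction i with
  | zero => simp [-one_div, Real.Gamma_one_half_eq, mul_self_sqrt pi_nonneg]
  | succ k ih =>
    have hk : (k : ℝ) + 1 / 2 ≠ 0 := by positivity
    have hk' : (k : ℝ) + 1 ≠ 0 := by positivity
    have hΓ : Real.Gamma ((k : ℝ) + 1) ≠ 0 := (Real.Gamma_pos_of_pos (by positivity)).ne'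
    rw [show 2 * (k + 1) = 2 * k + 2 by ring, integral_cos_pow_add_two_zero_pi, ih]
    push_cast
    rw [Real.Gamma_add_one hk', show (k : ℝ) + 1 + 1 / 2 = k + 1 / 2 + 1 by ring,
      Real.Gamma_add_one hk]
    field_simp

/-- The integrand after the substitution `z = -(√h / ω) cos θ`. -/
theorem moment_integrand_comp_cos {ω h θ : ℝ} (hω : 0 < ω) (hh : 0 < h) (n : ℕ)
    (hθ : 0 < sin θ) :
    (-(√h / ω) * cos θ) ^ n / √(2 * (h - ω ^ 2 * (-(√h / ω) * cos θ) ^ 2)) * (√h / ω * sin θ) =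
      (-(√h / ω)) ^ n / (√2 * ω) * cos θ ^ n := by
  have hz : 2 * (h - ω ^ 2 * (-(√h / ω) * cos θ) ^ 2) = 2 * (h * sin θ ^ 2) := by
    rw [sin_sq, mul_pow, neg_sq, div_pow, sq_sqrt hh.le]
    field_simp
  have h2 : √h ≠ 0 := (sqrt_pos.2 hh).ne'
  rw [hz, sqrt_mul zero_le_two, sqrt_mul hh.le, sqrt_sq hθ.le, mul_pow]
  field_simp

theorem moment_integrable_and_integral_eq {ω h : ℝ} (hω : 0 < ω) (hh : 0 < h) (n : ℕ) :
    IntervalIntegrable (fun z => z ^ n / √(2 * (h - ω ^ 2 * z ^ 2))) volume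
      (-(√h / ω)) (√h / ω) ∧
    ∫ z in (-(√h / ω))..(√h / ω), z ^ n / √(2 * (h - ω ^ 2 * z ^ 2)) =
      (-(√h / ω)) ^ n / (√2 * ω) * ∫ θ in (0 : ℝ)..π, cos θ ^ n := by
  let g : ℝ → ℝ := fun z => z ^ n / √(2 * (h - ω ^ 2 * z ^ 2))
  set f : ℝ → ℝ := fun θ => -(√h / ω) * cos θ with hf
  set f' : ℝ → ℝ := fun θ => √h / ω * sin θ with hf'
  have hcont : ContinuousOn f (uIcc 0 π) := by fun_prop
  have hsin : ∀ θ ∈ Ioo (min 0 π) (max 0 π), 0 < sin θ := by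
    rw [min_eq_left pi_nonneg, max_eq_right pi_nonneg]
    exact fun θ hθ => sin_pos_of_mem_Ioo hθ
  have hderiv : ∀ θ ∈ Ioo (min 0 π) (max 0 π), HasDerivAt f (f' θ) θ := fun θ _ => by
    simpa [hf, hf'] using (hasDerivAt_cos θ).const_mul (-(√h / ω))
  have hnonneg : ∀ θ ∈ Ioo (min 0 π) (max 0 π), 0 ≤ f' θ := fun θ hθ =>
    mul_nonneg (by positivity) (hsin θ hθ).le
  have h0 : f 0 = -(√h / ω) := by simp [hf]
  have hpi : f π = √h / ω := by simp [hf]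
  have heq : EqOn (fun θ => (-(√h / ω)) ^ n / (√2 * ω) * cos θ ^ n)
      (fun θ => (g ∘ f) θ * f' θ) (uIoo 0 π) := fun θ hθ =>
    (moment_integrand_comp_cos hω hh n (hsin θ hθ)).symm
  rw [← h0, ← hpi, ← integrable_comp_mul_deriv_iff_of_deriv_nonneg hcont hderiv hnonneg,
    ← integral_comp_mul_deriv_of_deriv_nonneg hcont hderiv hnonneg,
    ← intervalIntegral.integral_const_mul, h0]
  refine ⟨IntervalIntegrable.congr_uIoo ?_ heq, (integral_congr_uIoo heq).symm⟩
  exact Continuous.intervalIntegrable (by fun_prop) _ _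

/-- For `ω > 0`, `h > 0` and `n ∈ ℕ`, the improper integral
`∫_{-√h/ω}^{√h/ω} zⁿ/√(2(h - ω²z²)) dz` converges; it vanishes for odd `n`,
and for `n = 2i` it equals `√π · Γ(i + 1/2) · hⁱ / (√2 · ω^(2i+1) · Γ(i + 1))`.
In particular, for `n = 0` it equals `π/(√2 ω)`. -/
theorem moment_integral_formula
    (ω h : ℝ) (hω : 0 < ω) (hh : 0 < h) (n : ℕ) :
    IntervalIntegrable (fun z => z ^ n / Real.sqrt (2 * (h - ω ^ 2 * z ^ 2)))
      volume (-(Real.sqrt h / ω)) (Real.sqrt h / ω) ∧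
    (Odd n →
      (∫ z in (-(Real.sqrt h / ω))..(Real.sqrt h / ω),
        z ^ n / Real.sqrt (2 * (h - ω ^ 2 * z ^ 2))) = 0) ∧
    (∀ i : ℕ, n = 2 * i →
      (∫ z in (-(Real.sqrt h / ω))..(Real.sqrt h / ω),
        z ^ n / Real.sqrt (2 * (h - ω ^ 2 * z ^ 2)))
        = Real.sqrt π * Real.Gamma ((i : ℝ) + 1 / 2) * h ^ i /
            (Real.sqrt 2 * ω ^ (2 * i + 1) * Real.Gamma ((i : ℝ) + 1))) ∧
    (n = 0 →
      (∫ z in (-(Real.sqrt h / ω))..(Real.sqrt h / ω),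
        z ^ n / Real.sqrt (2 * (h - ω ^ 2 * z ^ 2))) = π / (Real.sqrt 2 * ω)) := by
  obtain ⟨hint, heq⟩ := moment_integrable_and_integral_eq hω hh n
  refine ⟨hint, fun hn => ?_, ?_, ?_⟩
  · rw [heq, integral_cos_pow_zero_pi_of_odd hn, mul_zero]
  · rintro i rfl
    rw [heq, integral_cos_pow_two_mul_zero_pi, Even.neg_pow (even_two_mul i), div_pow,
      pow_mul √h, sq_sqrt hh.le, pow_succ]
    field_simp
  · rintro rfl
    rw [heq]
    simp [div_eq_inv_mul]
end

section
/- Let ω > 0 and let x(z) = z + Σ_{i≥2} bᵢ zⁱ be a real power series with radius of convergence R > 0 (b₁ = 1). Then for all sufficiently small h > 0, ∫_{−√h/ω}^{√h/ω} x′(z)/√(2(h − ω²z²)) dz = (π/(√2 ω)) · (1 + Σ_{i≥1} T̃_{2i} hⁱ), where T̃_{2i} = 2 Γ(i + 3/2) b_{2i+1} / (√π · ω^{2i} · Γ(i + 1)) and the series Σ_{i≥1} T̃_{2i} hⁱ converges for all sufficiently small h > 0. -/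
open Real Filter Set Topology MeasureTheory intervalIntegral

theorem summable_abs_deriv_coeff_of_summable {b : ℕ → ℝ} {r s : ℝ} (hr : 0 < r) (hrs : r < s)
    (hb : Summable fun i : ℕ => b i * s ^ i) :
    Summable fun i : ℕ => |b i| * (i * r ^ (i - 1)) := by
  have hs : 0 < s := hr.trans hrs
  obtain ⟨C, hC⟩ : BddAbove (range fun i : ℕ => |b i * s ^ i|) :=
    Tendsto.bddAbove_range hb.tendsto_atTop_zero.abs
  have hlt : ‖r / s‖ < 1 := by
    rwa [Real.norm_of_nonneg (by positivity), div_lt_one hs]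
  have hgeom : Summable fun i : ℕ => C / r * ((i : ℝ) ^ 1 * (r / s) ^ i) :=
    (summable_pow_mul_geometric_of_norm_lt_one 1 hlt).mul_left (C / r)
  refine Summable.of_nonneg_of_le (fun i => by positivity) (fun i => ?_) hgeom
  have hi : |b i| * s ^ i ≤ C := by
    have := hC (mem_range_self i)
    simpa only [abs_mul, abs_pow, abs_of_pos hs] using this
  rcases i with _ | i
  · simp
  · have hle : |b (i + 1)| ≤ C / s ^ (i + 1) := (le_div_iff₀ (by positivity)).2 hi
    calc |b (i + 1)| * ((i + 1 : ℕ) * r ^ (i + 1 - 1))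
        ≤ C / s ^ (i + 1) * ((i + 1 : ℕ) * r ^ (i + 1 - 1)) := by gcongr
      _ = C / r * (((i + 1 : ℕ) : ℝ) ^ 1 * (r / s) ^ (i + 1)) := by
        rw [Nat.add_sub_cancel, div_pow]
        field_simp
        ring

theorem abs_deriv_term_le {b z r : ℝ} (i : ℕ) (hz : |z| ≤ r) :
    ‖b * (i * z ^ (i - 1))‖ ≤ |b| * (i * r ^ (i - 1)) := by
  rw [Real.norm_eq_abs, abs_mul, abs_mul, abs_pow, Nat.abs_cast]
  gcongr

theorem hasDerivAt_of_hasSum_pow {b : ℕ → ℝ} {X : ℝ → ℝ} {R r : ℝ} (hr : 0 < r) (hrR : r < R)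
    (hX : ∀ z : ℝ, |z| < R → HasSum (fun i : ℕ => b i * z ^ i) (X z))
    (hu : Summable fun i : ℕ => |b i| * (i * r ^ (i - 1))) {z : ℝ} (hz : |z| < r) :
    HasDerivAt X (∑' i : ℕ, b i * (i * z ^ (i - 1))) z := by
  have hmem : ∀ {y : ℝ}, y ∈ Ioo (-r) r ↔ |y| < r := by intro y; rw [abs_lt, mem_Ioo]
  have h := hasDerivAt_tsum_of_isPreconnected (g := fun i y => b i * y ^ i)
    (g' := fun (i : ℕ) y => b i * (i * y ^ (i - 1))) (y₀ := 0) hu isOpen_Ioo isPreconnected_Ioo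
    (fun i y _ => (hasDerivAt_pow i y).const_mul (b i))
    (fun i y hy => abs_deriv_term_le i (hmem.1 hy).le)
    (hmem.2 (by simpa using hr)) (hX 0 (by simpa using hr.trans hrR)).summable (hmem.2 hz)
  refine h.congr_of_eventuallyEq ?_
  filter_upwards [isOpen_Ioo.mem_nhds (hmem.2 hz)] with y hy
  exact (hX y ((hmem.1 hy).trans hrR)).tsum_eq.symm

theorem integral_sin_pow_odd_symm (k : ℕ) :
    ∫ x in (-(π / 2))..(π / 2), sin x ^ (2 * k + 1) = 0 := by
  induction k with
  | zero => simp
  | succ k ih =>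
    rw [show 2 * (k + 1) + 1 = (2 * k + 1) + 2 by ring, integral_sin_pow, ih]
    simp

theorem integral_sin_pow_even_symm (k : ℕ) :
    ∫ x in (-(π / 2))..(π / 2), sin x ^ (2 * k) =
      √π * Real.Gamma (k + 1 / 2) / Real.Gamma (k + 1) := by
  induction k with
  | zero =>
    have h := Real.mul_self_sqrt pi_pos.le
    simp only [mul_zero, pow_zero, Nat.cast_zero, zero_add, Real.Gamma_one_half_eq,
      Real.Gamma_one, h, intervalIntegral.integral_const, smul_eq_mul]
    ring
  | succ k ih =>
    have h₁ : Real.Gamma ((k + 1 : ℕ) + 1 / 2) = (k + 1 / 2) * Real.Gamma (k + 1 / 2) := by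
      rw [← Real.Gamma_add_one (by positivity)]
      push_cast
      ring_nf
    have h₂ : Real.Gamma ((k + 1 : ℕ) + 1) = (k + 1) * Real.Gamma (k + 1) := by
      rw [← Real.Gamma_add_one (by positivity)]
      push_cast
      ring_nf
    have h₃ : Real.Gamma (k + 1) ≠ 0 := (Real.Gamma_pos_of_pos (by positivity)).ne'
    rw [show 2 * (k + 1) = 2 * k + 2 by ring, integral_sin_pow, ih, h₁, h₂]
    simp only [cos_neg, cos_pi_div_two, mul_zero, sub_zero, zero_div, zero_add]
    push_cast
    field_simp

theorem image_mul_sin_Ioo {a : ℝ} (ha : 0 < a) :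
    (fun θ => a * sin θ) '' Ioo (-(π / 2)) (π / 2) = Ioo (-a) a := by
  ext z
  constructor
  · rintro ⟨θ, hθ, rfl⟩
    have h := sinPartialHomeomorph.map_source (x := θ) hθ
    have h' : sin θ ∈ Ioo (-1 : ℝ) 1 := h
    constructor <;> nlinarith [h'.1, h'.2]
  · rintro ⟨h₁, h₂⟩
    have h₁' : -1 < z / a := by rw [lt_div_iff₀ ha]; linarith
    have h₂' : z / a < 1 := by rw [div_lt_one ha]; exact h₂
    refine ⟨arcsin (z / a), ⟨neg_pi_div_two_lt_arcsin.2 h₁', arcsin_lt_pi_div_two.2 h₂'⟩, ?_⟩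
    simp only [sin_arcsin h₁'.le h₂'.le]
    field_simp

/-- The substitution `z = a sin θ` in an integral over `(-a, a)` whose integrand becomes a
continuous function of `θ`. -/
theorem intervalIntegrable_and_integral_eq_of_mul_sin {a : ℝ} (ha : 0 < a) {g G : ℝ → ℝ}
    (hG : Continuous G)
    (hg : ∀ θ ∈ Ioo (-(π / 2)) (π / 2), a * cos θ * g (a * sin θ) = G θ) :
    IntervalIntegrable g volume (-a) a ∧
      ∫ z in (-a)..a, g z = ∫ θ in (-(π / 2))..(π / 2), G θ := by
  have hπ : -(π / 2) ≤ π / 2 := by linarith [pi_pos]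
  have hderiv : ∀ θ ∈ Ioo (-(π / 2)) (π / 2),
      HasDerivWithinAt (fun θ => a * sin θ) (a * cos θ) (Ioo (-(π / 2)) (π / 2)) θ :=
    fun θ _ => ((hasDerivAt_sin θ).const_mul a).hasDerivWithinAt
  have hinj : InjOn (fun θ => a * sin θ) (Ioo (-(π / 2)) (π / 2)) := fun x hx y hy hxy =>
    injOn_sin (Ioo_subset_Icc_self hx) (Ioo_subset_Icc_self hy) (mul_left_cancel₀ ha.ne' hxy)
  have hcongr : EqOn (fun θ => |a * cos θ| • g (a * sin θ)) G (Ioo (-(π / 2)) (π / 2)) := by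
    intro θ hθ
    have hcos := cos_pos_of_mem_Ioo hθ
    simp only [smul_eq_mul]
    rw [abs_of_pos (by positivity), hg θ hθ]
  constructor
  · rw [intervalIntegrable_iff_integrableOn_Ioo_of_le (by linarith), ← image_mul_sin_Ioo ha,
      integrableOn_image_iff_integrableOn_abs_deriv_smul measurableSet_Ioo hderiv hinj,
      integrableOn_congr_fun hcongr measurableSet_Ioo,
      ← intervalIntegrable_iff_integrableOn_Ioo_of_le hπ]
    exact hG.intervalIntegrable _ _
  · rw [intervalIntegral.integral_of_le (by linarith), intervalIntegral.integral_of_le hπ,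
      integral_Ioc_eq_integral_Ioo, integral_Ioc_eq_integral_Ioo, ← image_mul_sin_Ioo ha,
      integral_image_eq_integral_abs_deriv_smul measurableSet_Ioo hderiv hinj]
    exact setIntegral_congr_fun measurableSet_Ioo hcongr

theorem continuous_tsum_deriv_mul_sin {b : ℕ → ℝ} {a : ℝ} (ha : 0 < a)
    (hu : Summable fun i : ℕ => |b i| * (i * a ^ (i - 1))) :
    Continuous fun θ => ∑' i : ℕ, b i * (i * (a * sin θ) ^ (i - 1)) :=
  continuous_tsum (fun i => by fun_prop) hu fun i θ => abs_deriv_term_le i (by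
    rw [abs_mul, abs_of_pos ha]
    exact mul_le_of_le_one_right ha.le (abs_sin_le_one θ))

/-- Only the odd coefficients contribute to the integral of the derivative of a power series along
`z = a sin θ`. -/
theorem hasSum_integral_tsum_deriv_mul_sin {b : ℕ → ℝ} {a : ℝ} (ha : 0 < a)
    (hu : Summable fun i : ℕ => |b i| * (i * a ^ (i - 1))) :
    HasSum (fun k : ℕ => b (2 * k + 1) * ((2 * k + 1) * a ^ (2 * k)) *
        (√π * Real.Gamma (k + 1 / 2) / Real.Gamma (k + 1)))
      (∫ θ in (-(π / 2))..(π / 2), ∑' i : ℕ, b i * (i * (a * sin θ) ^ (i - 1))) := by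
  have hle : ∀ i θ, ‖b i * (i * (a * sin θ) ^ (i - 1))‖ ≤ |b i| * (i * a ^ (i - 1)) :=
    fun i θ => abs_deriv_term_le i (by
      rw [abs_mul, abs_of_pos ha]
      exact mul_le_of_le_one_right ha.le (abs_sin_le_one θ))
  have h := intervalIntegral.hasSum_integral_of_dominated_convergence (μ := volume)
    (a := -(π / 2)) (b := π / 2) (F := fun (i : ℕ) θ => b i * (i * (a * sin θ) ^ (i - 1)))
    (f := fun θ => ∑' i : ℕ, b i * (i * (a * sin θ) ^ (i - 1)))
    (fun i _ => |b i| * (i * a ^ (i - 1)))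
    (fun i => (by fun_prop : Continuous fun θ : ℝ =>
      b i * (i * (a * sin θ) ^ (i - 1))).aestronglyMeasurable)
    (fun i => .of_forall fun θ _ => hle i θ)
    (.of_forall fun _ _ => hu)
    (by simp)
    (.of_forall fun θ _ => (Summable.of_norm_bounded hu fun i => hle i θ).hasSum)
  have hinj : Function.Injective fun k : ℕ => 2 * k + 1 := fun x y hxy => by simpa using hxy
  rw [← hinj.hasSum_iff] at h
  · refine h.congr_fun fun k => ?_
    simp only [Function.comp_apply, Nat.add_sub_cancel, mul_pow,
      intervalIntegral.integral_const_mul, integral_sin_pow_even_symm]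
    push_cast
    ring
  · intro i hi
    rcases Nat.even_or_odd' i with ⟨k, rfl | rfl⟩
    · rcases k with _ | k
      · simp
      · rw [show 2 * (k + 1) - 1 = 2 * k + 1 by lia]
        simp only [mul_pow, intervalIntegral.integral_const_mul, integral_sin_pow_odd_symm,
          mul_zero]
    · exact absurd ⟨k, rfl⟩ hi

/-- Let `x(z) = z + Σ_{i≥2} bᵢ zⁱ` be a real power series with radius of
convergence `R > 0`. Then for all sufficiently small `h > 0`,
`∫_{-√h/ω}^{√h/ω} x'(z)/√(2(h - ω²z²)) dz = (π/(√2 ω))(1 + Σ_{i≥1} T̃_{2i} hⁱ)`,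
where `T̃_{2i} = 2 Γ(i + 3/2) b_{2i+1} / (√π ω^{2i} Γ(i + 1))`, the series
converging for all sufficiently small `h > 0`. -/
theorem period_expansion_after_change_of_variable
    (ω : ℝ) (hω : 0 < ω)
    (b : ℕ → ℝ) (hb0 : b 0 = 0) (hb1 : b 1 = 1)
    (R : ℝ) (hR : 0 < R)
    (X : ℝ → ℝ)
    (hX : ∀ z : ℝ, |z| < R → HasSum (fun i : ℕ => b i * z ^ i) (X z)) :
    ∀ᶠ h in 𝓝[>] (0:ℝ),
      IntervalIntegrable (fun z => deriv X z / Real.sqrt (2 * (h - ω ^ 2 * z ^ 2)))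
        volume (-(Real.sqrt h / ω)) (Real.sqrt h / ω) ∧
      ∃ S : ℝ,
        HasSum (fun i : ℕ =>
          (2 * Real.Gamma ((i + 1 : ℕ) + 3 / 2) * b (2 * (i + 1) + 1) /
            (Real.sqrt π * ω ^ (2 * (i + 1)) * Real.Gamma ((i + 1 : ℕ) + 1)))
          * h ^ (i + 1)) S ∧
        (∫ z in (-(Real.sqrt h / ω))..(Real.sqrt h / ω),
          deriv X z / Real.sqrt (2 * (h - ω ^ 2 * z ^ 2)))
          = π / (Real.sqrt 2 * ω) * (1 + S) := by
  have hsmall : ∀ᶠ h in 𝓝[>] (0 : ℝ), √h / ω < R / 2 := by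
    have : Tendsto (fun h : ℝ => √h / ω) (𝓝 0) (𝓝 0) := by
      simpa using ((Real.continuous_sqrt.div_const ω).tendsto 0)
    exact (this.eventually_lt_const (by positivity)).filter_mono nhdsWithin_le_nhds
  filter_upwards [hsmall, self_mem_nhdsWithin] with h hh hpos
  have hh0 : 0 < h := hpos
  obtain ⟨a, ha_def⟩ : ∃ a, a = √h / ω := ⟨_, rfl⟩
  have ha : 0 < a := by rw [ha_def]; positivity
  have hsq : √h ^ 2 = h := Real.sq_sqrt hh0.le
  have haω : a * ω = √h := by rw [ha_def]; field_simp
  have hah : ω ^ 2 * a ^ 2 = h := by rw [← hsq, ← haω]; ring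
  rw [← ha_def] at hh ⊢
  have hb : Summable fun i : ℕ => b i * (3 * R / 4) ^ i :=
    (hX _ (by rw [abs_of_pos (by positivity)]; linarith)).summable
  have hua := summable_abs_deriv_coeff_of_summable ha (by linarith) hb
  have hur := summable_abs_deriv_coeff_of_summable (half_pos hR) (by linarith) hb
  have hderiv : ∀ θ, deriv X (a * sin θ) = ∑' i : ℕ, b i * (i * (a * sin θ) ^ (i - 1)) := by
    intro θ
    refine (hasDerivAt_of_hasSum_pow (half_pos hR) (half_lt_self hR) hX hur ?_).deriv
    rw [abs_mul, abs_of_pos ha]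
    exact (mul_le_of_le_one_right ha.le (abs_sin_le_one θ)).trans_lt hh
  obtain ⟨hint, heq⟩ := intervalIntegrable_and_integral_eq_of_mul_sin ha
    (g := fun z => deriv X z / √(2 * (h - ω ^ 2 * z ^ 2)))
    ((continuous_tsum_deriv_mul_sin ha hua).const_mul (1 / (√2 * ω))) (by
      intro θ hθ
      have hcos := cos_pos_of_mem_Ioo hθ
      have hroot : √(2 * (h - ω ^ 2 * (a * sin θ) ^ 2)) = √2 * (a * ω * cos θ) := by
        rw [Real.sqrt_mul (by norm_num)]
        congr 1
        rw [Real.sqrt_eq_iff_mul_self_eq_of_pos (by positivity), ← hah]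
        linear_combination ω ^ 2 * a ^ 2 * sin_sq_add_cos_sq θ
      simp only [hroot, hderiv]
      field_simp)
  refine ⟨hint, ?_⟩
  have hsum := hasSum_integral_tsum_deriv_mul_sin ha hua
  rw [intervalIntegral.integral_const_mul] at heq
  set T := ∫ θ in (-(π / 2))..(π / 2), ∑' i : ℕ, b i * (i * (a * sin θ) ^ (i - 1))
  refine ⟨T / π - 1, ?_, by rw [heq]; field_simp; ring⟩
  have hsum' := (hasSum_nat_add_iff' 1).2 (hsum.div_const π)
  have hπ : √π ^ 2 = π := Real.sq_sqrt pi_pos.le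
  have hzero : ∑ k ∈ Finset.range 1, b (2 * k + 1) * ((2 * k + 1) * a ^ (2 * k)) *
      (√π * Real.Gamma (k + 1 / 2) / Real.Gamma (k + 1)) / π = 1 := by
    simp only [Finset.sum_range_one, mul_zero, zero_add, hb1, Nat.cast_zero, pow_zero,
      Real.Gamma_one_half_eq, Real.Gamma_one, Real.mul_self_sqrt pi_pos.le]
    field_simp
  rw [hzero] at hsum'
  refine hsum'.congr_fun fun k => ?_
  have hΓ : Real.Gamma ((k + 1 : ℕ) + 3 / 2) =
      ((k + 1 : ℕ) + 1 / 2) * Real.Gamma ((k + 1 : ℕ) + 1 / 2) := by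
    rw [← Real.Gamma_add_one (by positivity)]
    ring_nf
  have hΓ0 : Real.Gamma ((k + 1 : ℕ) + 1) ≠ 0 := (Real.Gamma_pos_of_pos (by positivity)).ne'
  have hpow : h ^ (k + 1) = ω ^ (2 * (k + 1)) * a ^ (2 * (k + 1)) := by
    rw [← hah, ← mul_pow, ← mul_pow, pow_mul]
  rw [hΓ, hpow]
  nth_rewrite 3 [← hπ]
  field_simp
end

section
/- Let m ≥ 3 be an integer and let V : ℝ → ℝ be real-analytic in a neighborhood of 0 with V(0) = V′(0) = ⋯ = V^{(m−1)}(0) = 0 and V^{(m)}(0) ≠ 0, and suppose there is δ > 0 such that V(x) > 0 for all x ∈ (−δ, 0). For small h > 0 let x_h ∈ (−δ, 0) be the point closest to 0 with V(x_h) = h. Then the improper integral ∫_{x_h}^{0} dx/√(2(h − V(x))) converges for all sufficiently small h > 0 and tends to +∞ as h → 0⁺. -/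
open Real Filter Set Topology MeasureTheory intervalIntegral

/-- If `G` is analytic at `0` with `0 < G 0`, then `x ↦ (-x) ^ m * G x` is antitone on some
interval `[-ε, 0]`. -/
theorem exists_antitoneOn_neg_pow_mul {m : ℕ} (hm : m ≠ 0) {G : ℝ → ℝ} (hG : AnalyticAt ℝ G 0)
    (hG0 : 0 < G 0) :
    ∃ ε > 0, AntitoneOn (fun x => (-x) ^ m * G x) (Icc (-ε) 0) := by
  have hcont : ContinuousAt (fun x => m * G x + x * deriv G x) 0 :=
    (continuousAt_const.mul hG.continuousAt).add
      (continuousAt_id.mul hG.deriv.continuousAt)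
  have hpos : ∀ᶠ x in 𝓝 (0 : ℝ), 0 < m * G x + x * deriv G x := by
    refine hcont.eventually (lt_mem_nhds ?_)
    have : (0 : ℝ) < m := by exact_mod_cast Nat.pos_of_ne_zero hm
    simp only [zero_mul, add_zero]
    positivity
  obtain ⟨ε, hε, h⟩ := Metric.eventually_nhds_iff.1 (hpos.and hG.eventually_analyticAt)
  have hball : ∀ x ∈ Icc (-(ε / 2)) 0, dist x 0 < ε := by
    intro x hx
    rw [Real.dist_eq, sub_zero, abs_of_nonpos hx.2]
    linarith [hx.1]
  have hderiv : ∀ x ∈ Icc (-(ε / 2)) 0, HasDerivAt (fun x => (-x) ^ m * G x)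
      (-((-x) ^ (m - 1) * (m * G x + x * deriv G x))) x := by
    intro x hx
    have h1 := (h (hball x hx)).2.differentiableAt.hasDerivAt
    have h2 := (((hasDerivAt_id x).neg).pow m).mul h1
    refine h2.congr_deriv ?_
    obtain ⟨k, rfl⟩ := Nat.exists_eq_succ_of_ne_zero hm
    simp
    ring
  refine ⟨ε / 2, half_pos hε, antitoneOn_of_deriv_nonpos (convex_Icc _ _)
    (fun x hx => (hderiv x hx).continuousAt.continuousWithinAt)
    (fun x hx => (hderiv x (interior_subset hx)).differentiableAt.differentiableWithinAt)
    (fun x hx => ?_)⟩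
  have hx' := interior_subset hx
  rw [(hderiv x hx').deriv, neg_nonpos]
  have := (h (hball x hx')).1
  exact mul_nonneg (pow_nonneg (neg_nonneg.2 hx'.2) _) this.le

/-- A potential vanishing to order exactly `m` at `0` and positive on the left of `0` is bounded
above by a multiple of `(-x) ^ m` on a left neighborhood of `0`, and it decreases there at least as
fast as another positive multiple of `(-x) ^ m`. -/
theorem exists_local_bounds {m : ℕ} (hm : m ≠ 0) {V : ℝ → ℝ} (hV : AnalyticAt ℝ V 0)
    (hord : analyticOrderAt V 0 = m) {δ : ℝ} (hδ : 0 < δ)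
    (hpos : ∀ x ∈ Ioo (-δ) 0, 0 < V x) :
    ∃ C > 0, ∃ d > 0, ∃ ε > 0, ContinuousOn V (Icc (-ε) 0) ∧
      (∀ x ∈ Icc (-ε) 0, V x ≤ C * (-x) ^ m) ∧
      AntitoneOn (fun x => V x - d * (-x) ^ m) (Icc (-ε) 0) := by
  obtain ⟨g, hg, hg0, hVg⟩ := hV.analyticOrderAt_eq_natCast.1 hord
  set G : ℝ → ℝ := fun x => (-1) ^ m * g x with hGdef
  have hG : AnalyticAt ℝ G 0 := analyticAt_const.mul hg
  have hVG : ∀ᶠ x in 𝓝 (0 : ℝ), V x = (-x) ^ m * G x := by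
    filter_upwards [hVg] with x hx
    rw [hx, hGdef, sub_zero, smul_eq_mul, ← mul_assoc, ← mul_pow]
    simp
  have hG0 : 0 < G 0 := by
    refine lt_of_le_of_ne ?_ (by simp [hGdef, hg0])
    refine ge_of_tendsto (hG.continuousAt.tendsto.mono_left (nhdsWithin_le_nhds (s := Iio 0))) ?_
    filter_upwards [hVG.filter_mono nhdsWithin_le_nhds, Ioo_mem_nhdsLT (neg_lt_zero.2 hδ)]
      with x hx hxδ
    have hVx := hpos x hxδ
    rw [hx] at hVx
    exact (pos_of_mul_pos_right hVx (pow_nonneg (neg_nonneg.2 hxδ.2.le) _)).le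
  obtain ⟨ε₁, hε₁, hanti⟩ := exists_antitoneOn_neg_pow_mul hm (hG.sub analyticAt_const)
    (show 0 < (G - fun _ : ℝ => G 0 / 2) 0 by rw [Pi.sub_apply]; linarith)
  have hGle : ∀ᶠ x in 𝓝 (0 : ℝ), G x < 2 * G 0 :=
    hG.continuousAt.eventually (gt_mem_nhds (by linarith))
  obtain ⟨ε₂, hε₂, h⟩ :=
    Metric.eventually_nhds_iff.1 (hVG.and (hGle.and hV.eventually_analyticAt))
  have hball : ∀ x ∈ Icc (-min ε₁ (ε₂ / 2)) 0, dist x 0 < ε₂ := by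
    intro x hx
    rw [Real.dist_eq, sub_zero, abs_of_nonpos hx.2]
    linarith [hx.1, min_le_right ε₁ (ε₂ / 2)]
  refine ⟨2 * G 0, by positivity, G 0 / 2, by positivity, min ε₁ (ε₂ / 2), by positivity,
    fun x hx => (h (hball x hx)).2.2.continuousAt.continuousWithinAt, fun x hx => ?_, ?_⟩
  · rw [(h (hball x hx)).1, mul_comm]
    exact mul_le_mul_of_nonneg_right (h (hball x hx)).2.1.le (pow_nonneg (neg_nonneg.2 hx.2) _)
  · refine (hanti.mono (Icc_subset_Icc_left (neg_le_neg (min_le_left _ _)))).congr ?_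
    intro x hx
    simp only [Pi.sub_apply]
    rw [(h (hball x hx)).1]
    ring

/-- If `V` decreases on `[a, 0]` at least as fast as `d * (-x) ^ m`, then `V a - V x` is bounded
below by a multiple of `x - a`. -/
theorem mul_sub_le_sub_of_antitoneOn {m : ℕ} (hm : m ≠ 0) {V : ℝ → ℝ} {a d : ℝ} (hd : 0 ≤ d)
    (hanti : AntitoneOn (fun x => V x - d * (-x) ^ m) (Icc a 0)) {x : ℝ} (hx : x ∈ Icc a 0) :
    d * (-a) ^ (m - 1) * (x - a) ≤ V a - V x := by
  have h1 := hanti (left_mem_Icc.2 (hx.1.trans hx.2)) hx hx.1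
  obtain ⟨k, rfl⟩ := Nat.exists_eq_succ_of_ne_zero hm
  have h2 : (-x) ^ k ≤ (-a) ^ k :=
    pow_le_pow_left₀ (neg_nonneg.2 hx.2) (neg_le_neg hx.1) k
  have h3 : (-x) ^ k * (-x) ≤ (-a) ^ k * (-x) :=
    mul_le_mul_of_nonneg_right h2 (neg_nonneg.2 hx.2)
  have h4 : (-a) ^ k * (x - a) ≤ (-a) ^ (k + 1) - (-x) ^ (k + 1) := by
    rw [pow_succ, pow_succ]
    linarith
  have h5 := mul_le_mul_of_nonneg_left h4 hd
  simp only [Nat.succ_eq_add_one, Nat.add_sub_cancel] at h1 ⊢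
  rw [mul_assoc]
  linarith

/-- If `h - V` is bounded below on `[a, b]` by a positive multiple of `x - a`, then the transit
time integral from `a` to `b` converges. -/
theorem intervalIntegrable_one_div_sqrt_s13 {V : ℝ → ℝ} {a b h q : ℝ} (hab : a ≤ b) (hq : 0 < q)
    (hcont : ContinuousOn V (Icc a b)) (hle : ∀ x ∈ Icc a b, q * (x - a) ≤ h - V x) :
    IntervalIntegrable (fun x => 1 / √(2 * (h - V x))) volume a b := by
  have hpow : IntervalIntegrable (fun x => (√(2 * q))⁻¹ * (x - a) ^ (-(1 / 2) : ℝ)) volume a b := by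
    have := (intervalIntegrable_rpow' (a := 0) (b := b - a)
      (show (-1 : ℝ) < -(1 / 2) by norm_num)).comp_sub_right a
    simpa using this.const_mul (√(2 * q))⁻¹
  refine hpow.mono_fun' ?_ ?_
  · rw [uIoc_of_le hab]
    have hV : AEMeasurable V (volume.restrict (Ioc a b)) :=
      (hcont.mono Ioc_subset_Icc_self).aemeasurable measurableSet_Ioc
    exact ((((hV.const_sub h).const_mul 2).sqrt).const_div 1).aestronglyMeasurable
  · rw [uIoc_of_le hab]
    filter_upwards [ae_restrict_mem measurableSet_Ioc] with x hx
    have hxa : 0 < x - a := sub_pos.2 hx.1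
    have hx' := hle x (Ioc_subset_Icc_self hx)
    rw [Real.norm_of_nonneg (by positivity), Real.rpow_neg hxa.le, ← Real.sqrt_eq_rpow,
      ← mul_inv, ← Real.sqrt_mul (by positivity), one_div]
    have : 0 < 2 * q * (x - a) := by positivity
    exact inv_anti₀ (Real.sqrt_pos.2 this) (Real.sqrt_le_sqrt (by linarith))

/-- If `0 ≤ V < h` on `(a, b)`, then the transit time from `a` to `b` is at least the time
`(b - a) / √(2 * h)` needed at maximal speed. -/
theorem div_sqrt_le_integral {V : ℝ → ℝ} {a b h : ℝ} (hab : a ≤ b)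
    (hint : IntervalIntegrable (fun x => 1 / √(2 * (h - V x))) volume a b)
    (hV : ∀ x ∈ Ioo a b, 0 ≤ V x ∧ V x < h) :
    (b - a) / √(2 * h) ≤ ∫ x in a..b, 1 / √(2 * (h - V x)) := by
  have := integral_mono_on_of_le_Ioo hab (intervalIntegrable_const (c := 1 / √(2 * h))) hint
    (fun x hx => one_div_le_one_div_of_le
      (Real.sqrt_pos.2 (by linarith [(hV x hx).2]))
      (Real.sqrt_le_sqrt (by linarith [(hV x hx).1])))
  rwa [intervalIntegral.integral_const, smul_eq_mul, mul_one_div] at this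

/-- The turning points closest to `0` tend to `0` from the left. -/
theorem tendsto_turning_point {V : ℝ → ℝ} {ε : ℝ} (hε : 0 < ε)
    (hcont : ContinuousOn V (Icc (-ε) 0)) (hV0 : V 0 = 0) (hpos : ∀ x ∈ Ico (-ε) 0, 0 < V x)
    {xh : ℝ → ℝ} (hxh : ∀ᶠ h in 𝓝[>] (0 : ℝ), xh h < 0 ∧ ∀ x ∈ Ioo (xh h) 0, V x ≠ h) :
    Tendsto xh (𝓝[>] (0 : ℝ)) (𝓝[<] 0) := by
  refine tendsto_nhdsWithin_iff.2 ⟨tendsto_order.2 ⟨fun a ha => ?_, fun a ha => ?_⟩,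
    hxh.mono fun h hh => hh.1⟩
  · have hb : max a (-ε) < 0 := max_lt ha (neg_lt_zero.2 hε)
    filter_upwards [hxh, Ioo_mem_nhdsGT (hpos _ ⟨le_max_right _ _, hb⟩)] with h hh hIoo
    obtain ⟨x, hx, rfl⟩ := intermediate_value_Ioo' hb.le
      (hcont.mono (Icc_subset_Icc_left (le_max_right _ _))) (by rwa [hV0])
    by_contra! hle
    exact hh.2 x ⟨(hle.trans (le_max_left _ _)).trans_lt hx.1, hx.2⟩ rfl
  · exact hxh.mono fun h hh => hh.1.trans ha

/-- Let `m ≥ 3` and let `V` be real-analytic near `0`, vanishing to order `m`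
at `0` and positive on `(-δ, 0)`. With `x_h ∈ (-δ, 0)` the left turning point
at energy level `h`, the improper integral `∫_{x_h}^{0} dx/√(2(h - V(x)))`
converges for all sufficiently small `h > 0` and tends to `+∞` as `h → 0⁺`. -/
theorem transit_time_blows_up_degenerate
    (m : ℕ) (hm : 3 ≤ m)
    (V : ℝ → ℝ) (hVA : AnalyticAt ℝ V 0)
    (hord : (∀ k < m, iteratedDeriv k V 0 = 0) ∧ iteratedDeriv m V 0 ≠ 0)
    (δ : ℝ) (hδ : 0 < δ) (hVpos : ∀ x ∈ Ioo (-δ) 0, 0 < V x)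
    -- `x_h ∈ (-δ, 0)` is the point closest to `0` with `V(x_h) = h`
    (xh : ℝ → ℝ)
    (hxh : ∀ᶠ h in 𝓝[>] (0:ℝ), xh h ∈ Ioo (-δ) 0 ∧ V (xh h) = h ∧
      ∀ x ∈ Ioo (xh h) 0, V x ≠ h) :
    (∀ᶠ h in 𝓝[>] (0:ℝ),
      IntervalIntegrable (fun x => 1 / Real.sqrt (2 * (h - V x)))
        volume (xh h) 0) ∧
    Tendsto (fun h => ∫ x in xh h..0, 1 / Real.sqrt (2 * (h - V x)))
      (𝓝[>] (0:ℝ)) atTop := by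
  have hm0 : m ≠ 0 := by omega
  obtain ⟨C, hC, d, hd, ε, hε, hcont, hVle, hanti⟩ := exists_local_bounds hm0 hVA
    ((analyticOrderAt_eq_nat_iff_iteratedDeriv_eq_zero hVA).2 hord) hδ hVpos
  have hV0 : V 0 = 0 := by simpa using hord.1 0 (by omega)
  have hlin : ∀ a ∈ Ico (-ε) 0, ∀ x ∈ Icc a 0, d * (-a) ^ (m - 1) * (x - a) ≤ V a - V x :=
    fun a ha x hx => mul_sub_le_sub_of_antitoneOn hm0 hd.le
      (hanti.mono (Icc_subset_Icc_left ha.1)) hx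
  have hq : ∀ a < 0, 0 < d * (-a) ^ (m - 1) :=
    fun a ha => mul_pos hd (pow_pos (neg_pos.2 ha) _)
  have hlt : ∀ a ∈ Ico (-ε) 0, ∀ x ∈ Ioc a 0, V x < V a := fun a ha x hx =>
    sub_pos.1 ((mul_pos (hq a ha.2) (sub_pos.2 hx.1)).trans_le
      (hlin a ha x (Ioc_subset_Icc_self hx)))
  have hpos : ∀ x ∈ Ico (-ε) 0, 0 < V x := fun x hx => by
    simpa [hV0] using hlt x hx 0 ⟨hx.2, le_rfl⟩
  have htend := tendsto_turning_point hε hcont hV0 hpos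
    (hxh.mono fun h hh => ⟨hh.1.2, hh.2.2⟩)
  have hmem : ∀ᶠ h in 𝓝[>] (0 : ℝ), xh h ∈ Ico (-ε) 0 :=
    htend.eventually (Ico_mem_nhdsLT (neg_lt_zero.2 hε))
  have hint : ∀ᶠ h in 𝓝[>] (0 : ℝ),
      IntervalIntegrable (fun x => 1 / √(2 * (h - V x))) volume (xh h) 0 := by
    filter_upwards [hxh, hmem] with h hh ha
    refine intervalIntegrable_one_div_sqrt_s13 ha.2.le (hq _ ha.2)
      (hcont.mono (Icc_subset_Icc_left ha.1)) fun x hx => ?_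
    simpa only [hh.2.1] using hlin _ ha x hx
  refine ⟨hint, ?_⟩
  have hlow : Tendsto (fun a : ℝ => √((2 * C)⁻¹ * (-a)⁻¹)) (𝓝[<] 0) atTop := by
    refine Real.tendsto_sqrt_atTop.comp (Tendsto.const_mul_atTop (by positivity) ?_)
    have : Tendsto (fun a : ℝ => -a) (𝓝[<] 0) (𝓝[>] 0) := by
      simpa using tendsto_neg_nhdsLT (a := (0 : ℝ))
    exact tendsto_inv_nhdsGT_zero.comp this
  refine tendsto_atTop_mono' _ ?_ (hlow.comp htend)
  filter_upwards [hxh, hmem, hint, htend.eventually (Ico_mem_nhdsLT neg_one_lt_zero)]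
    with h hh ha hi ha1
  refine le_trans ?_ (div_sqrt_le_integral ha.2.le hi fun x hx => ⟨?_, ?_⟩)
  · have hb : 0 < -xh h := neg_pos.2 ha.2
    have hh0 : 0 < h := hh.2.1 ▸ hpos _ ha
    have hle : h ≤ C * (-xh h) ^ 3 := by
      calc h = V (xh h) := hh.2.1.symm
        _ ≤ C * (-xh h) ^ m := hVle _ (Ico_subset_Icc_self ha)
        _ ≤ C * (-xh h) ^ 3 := by
          gcongr ?_ * ?_
          exact pow_le_pow_of_le_one hb.le (by linarith [ha1.1]) hm
    rw [Function.comp_apply, zero_sub, le_div_iff₀ (by positivity),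
      ← Real.sqrt_mul (by positivity)]
    refine (Real.sqrt_le_left hb.le).2 ?_
    rw [← mul_inv, inv_mul_le_iff₀ (by positivity)]
    linarith
  · exact (hpos x ⟨ha.1.trans hx.1.le, hx.2⟩).le
  · simpa only [hh.2.1] using hlt _ ha x (Ioo_subset_Ioc_self hx)
end

section
/- Let V : ℝ → ℝ be real-analytic in a neighborhood of 0 with V(0) = 0 and V′(0) = c > 0, and for small h > 0 let x₊(h) > 0 be the unique small point with V(x₊(h)) = h. Then the transit time τ(h) = 2∫_{0}^{x₊(h)} dx/√(2(h − V(x))) is finite for all sufficiently small h > 0 and satisfies lim_{h→0⁺} τ(h)/√(2h) = 2/c. -/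
open Real Filter Set Topology MeasureTheory intervalIntegral

theorem one_div_sqrt_mul_eq_rpow {a t : ℝ} (ha : 0 < a) (ht : 0 ≤ t) :
    1 / √(2 * (a * t)) = (√(2 * a))⁻¹ * t ^ (-(1 / 2) : ℝ) := by
  rw [← mul_assoc, Real.sqrt_mul (by positivity), Real.rpow_neg ht, ← Real.sqrt_eq_rpow,
    one_div, mul_inv]

theorem intervalIntegrable_one_div_sqrt_mul_sub {a p : ℝ} (ha : 0 < a) (hp : 0 < p) :
    IntervalIntegrable (fun x => 1 / √(2 * (a * (p - x)))) volume 0 p := by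
  have h : IntervalIntegrable (fun t : ℝ => (√(2 * a))⁻¹ * t ^ (-(1 / 2) : ℝ)) volume p 0 :=
    (intervalIntegral.intervalIntegrable_rpow' (by norm_num)).const_mul _
  have h' := h.comp_sub_left p
  rw [sub_self, sub_zero] at h'
  refine h'.congr fun x hx => ?_
  rw [uIoc_of_le hp.le] at hx
  exact (one_div_sqrt_mul_eq_rpow ha (sub_nonneg.2 hx.2)).symm

theorem integral_one_div_sqrt_mul_sub {a p : ℝ} (ha : 0 < a) (hp : 0 < p) :
    ∫ x in (0 : ℝ)..p, 1 / √(2 * (a * (p - x))) = 2 * √p / √(2 * a) := by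
  rw [intervalIntegral.integral_comp_sub_left (fun t => 1 / √(2 * (a * t))) p, sub_self, sub_zero]
  have h : ∫ t in (0 : ℝ)..p, 1 / √(2 * (a * t)) =
      ∫ t in (0 : ℝ)..p, (√(2 * a))⁻¹ * t ^ (-(1 / 2) : ℝ) := by
    refine intervalIntegral.integral_congr fun t ht => ?_
    rw [uIcc_of_le hp.le] at ht
    exact one_div_sqrt_mul_eq_rpow ha ht.1
  rw [h, intervalIntegral.integral_const_mul, integral_rpow (Or.inl (by norm_num))]
  norm_num
  rw [← Real.sqrt_eq_rpow]
  ring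

/-- If `h - V` lies between two linear functions vanishing at `p`, then the transit integral over
`[0, p]` converges and lies between the corresponding values for linear potentials. -/
theorem transit_integral_bounds {V : ℝ → ℝ} {a b h p : ℝ} (ha : 0 < a) (hb : 0 < b) (hp : 0 < p)
    (hV0 : V 0 = 0) (hVc : ContinuousOn V (Ioc 0 p))
    (hlow : ∀ x ∈ Icc 0 p, a * (p - x) ≤ h - V x)
    (hupp : ∀ x ∈ Icc 0 p, h - V x ≤ b * (p - x)) :
    IntervalIntegrable (fun x => 1 / √(2 * (h - V x))) volume 0 p ∧
      2 / b ≤ (2 * ∫ x in (0 : ℝ)..p, 1 / √(2 * (h - V x))) / √(2 * h) ∧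
      (2 * ∫ x in (0 : ℝ)..p, 1 / √(2 * (h - V x))) / √(2 * h) ≤ 2 / a := by
  have hle : ∀ x ∈ Ioo 0 p, 1 / √(2 * (h - V x)) ≤ 1 / √(2 * (a * (p - x))) := by
    intro x hx
    have hpx : 0 < p - x := sub_pos.2 hx.2
    have := hlow x (Ioo_subset_Icc_self hx)
    exact one_div_le_one_div_of_le (by positivity) (Real.sqrt_le_sqrt (by linarith))
  have hge : ∀ x ∈ Ioo 0 p, 1 / √(2 * (b * (p - x))) ≤ 1 / √(2 * (h - V x)) := by
    intro x hx
    have hpx : 0 < a * (p - x) := mul_pos ha (sub_pos.2 hx.2)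
    have h1 := hlow x (Ioo_subset_Icc_self hx)
    have h2 := hupp x (Ioo_subset_Icc_self hx)
    exact one_div_le_one_div_of_le (Real.sqrt_pos.2 (by linarith))
      (Real.sqrt_le_sqrt (by linarith))
  have hIa := intervalIntegrable_one_div_sqrt_mul_sub ha hp
  have hIb := intervalIntegrable_one_div_sqrt_mul_sub hb hp
  have hI : IntervalIntegrable (fun x => 1 / √(2 * (h - V x))) volume 0 p := by
    rw [intervalIntegrable_iff_integrableOn_Ioo_of_le hp.le] at hIa ⊢
    refine Integrable.mono' hIa ?_ ?_
    · refine ContinuousOn.aestronglyMeasurable (fun x hx => ?_) measurableSet_Ioo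
      have hpx : 0 < a * (p - x) := mul_pos ha (sub_pos.2 hx.2)
      have h1 := hlow x (Ioo_subset_Icc_self hx)
      have hVx : ContinuousWithinAt V (Ioo 0 p) x :=
        (hVc.mono Ioo_subset_Ioc_self) x hx
      exact continuousWithinAt_const.div
        ((continuousWithinAt_const.mul (continuousWithinAt_const.sub hVx)).sqrt)
        (Real.sqrt_pos.2 (by linarith)).ne'
    · filter_upwards [ae_restrict_mem measurableSet_Ioo] with x hx
      rw [Real.norm_of_nonneg (by positivity)]
      exact hle x hx
  have hup := intervalIntegral.integral_mono_on_of_le_Ioo hp.le hI hIa hle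
  have hlo := intervalIntegral.integral_mono_on_of_le_Ioo hp.le hIb hI hge
  rw [integral_one_div_sqrt_mul_sub ha hp] at hup
  rw [integral_one_div_sqrt_mul_sub hb hp] at hlo
  have hah : a * p ≤ h := by simpa [hV0] using hlow 0 ⟨le_rfl, hp.le⟩
  have hhb : h ≤ b * p := by simpa [hV0] using hupp 0 ⟨le_rfl, hp.le⟩
  have hh : 0 < h := (mul_pos ha hp).trans_le hah
  have hs : 0 < √(2 * h) := Real.sqrt_pos.2 (by positivity)
  have key : ∀ d : ℝ, 0 < d → 2 * (2 * √p / √(2 * d)) = 2 / d * √(2 * (d * p)) := by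
    intro d hd
    have hd' : 0 < √(2 * d) := Real.sqrt_pos.2 (by positivity)
    rw [← mul_assoc 2 d p, Real.sqrt_mul (by positivity) p]
    field_simp
    rw [Real.sq_sqrt (by positivity)]
  refine ⟨hI, ?_, ?_⟩
  · rw [le_div_iff₀ hs]
    calc 2 / b * √(2 * h) ≤ 2 / b * √(2 * (b * p)) := by gcongr
      _ = 2 * (2 * √p / √(2 * b)) := (key b hb).symm
      _ ≤ _ := by gcongr
  · rw [div_le_iff₀ hs]
    calc _ ≤ 2 * (2 * √p / √(2 * a)) := by gcongr
      _ = 2 / a * √(2 * (a * p)) := key a ha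
      _ ≤ 2 / a * √(2 * h) := by gcongr

/-- A function analytic at `0` is continuous on some `[0, r]`, with difference quotients there
within `ε` of its derivative at `0`. -/
theorem exists_continuousOn_and_slope_bounds {V : ℝ → ℝ} (hVA : AnalyticAt ℝ V 0) {ε : ℝ}
    (hε : 0 < ε) :
    ∃ r > 0, ContinuousOn V (Icc 0 r) ∧ ∀ x ∈ Icc 0 r, ∀ y ∈ Icc x r,
      (deriv V 0 - ε) * (y - x) ≤ V y - V x ∧ V y - V x ≤ (deriv V 0 + ε) * (y - x) := by
  have hs := hVA.hasStrictDerivAt.hasStrictFDerivAt.isLittleO.def hε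
  rw [nhds_prod_eq] at hs
  obtain ⟨s, hs0, hs⟩ := Filter.eventually_prod_self_iff'.1 hs
  have hc : ∀ᶠ x in 𝓝 (0 : ℝ), AnalyticAt ℝ V x := hVA.eventually_analyticAt
  obtain ⟨r, hr, hball⟩ := Metric.eventually_nhds_iff.1 (hc.and hs0)
  have hmem : ∀ x ∈ Icc 0 (r / 2), dist x 0 < r := by
    intro x hx
    rw [Real.dist_eq, sub_zero, abs_of_nonneg hx.1]
    linarith [hx.2]
  refine ⟨r / 2, by positivity, fun x hx =>
    (hball (hmem x hx)).1.continuousAt.continuousWithinAt, fun x hx y hy => ?_⟩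
  have hb := hs y (hball (hmem y ⟨hx.1.trans hy.1, hy.2⟩)).2 x (hball (hmem x hx)).2
  simp only [ContinuousLinearMap.toSpanSingleton_apply, smul_eq_mul, Real.norm_eq_abs] at hb
  rw [abs_of_nonneg (sub_nonneg.2 hy.1), abs_le] at hb
  constructor <;> linarith [hb.1, hb.2]

/-- Let `V` be real-analytic near `0` with `V(0) = 0` and `V'(0) = c > 0`, and
let `x₊(h) > 0` be the unique small point with `V(x₊(h)) = h`. Then the transit
time `τ(h) = 2∫_{0}^{x₊(h)} dx/√(2(h - V(x)))` is finite for all sufficiently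
small `h > 0` and satisfies `lim_{h→0⁺} τ(h)/√(2h) = 2/c`. -/
theorem transit_time_of_invisible_tangency
    (V : ℝ → ℝ) (hVA : AnalyticAt ℝ V 0) (hV0 : V 0 = 0)
    (c : ℝ) (hc : 0 < c) (hVc : deriv V 0 = c)
    -- `x₊(h) > 0` is the unique small point with `V(x₊(h)) = h`
    (xp : ℝ → ℝ)
    (hxp : ∀ᶠ h in 𝓝[>] (0:ℝ), 0 < xp h ∧ V (xp h) = h ∧
      ∀ x ∈ Ioo 0 (xp h), V x ≠ h)
    -- the transit time
    (τ : ℝ → ℝ)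
    (hτ : ∀ h, τ h = 2 * ∫ x in (0:ℝ)..xp h, 1 / Real.sqrt (2 * (h - V x))) :
    (∀ᶠ h in 𝓝[>] (0:ℝ),
      IntervalIntegrable (fun x => 1 / Real.sqrt (2 * (h - V x)))
        volume 0 (xp h)) ∧
    Tendsto (fun h => τ h / Real.sqrt (2 * h)) (𝓝[>] (0:ℝ)) (𝓝 (2 / c)) := by
  have main : ∀ ε : ℝ, 0 < ε → ε < c → ∀ᶠ h in 𝓝[>] (0 : ℝ),
      IntervalIntegrable (fun x => 1 / √(2 * (h - V x))) volume 0 (xp h) ∧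
        2 / (c + ε) ≤ τ h / √(2 * h) ∧ τ h / √(2 * h) ≤ 2 / (c - ε) := by
    intro ε hε hεc
    obtain ⟨r, hr, hcont, hslope⟩ := exists_continuousOn_and_slope_bounds hVA hε
    rw [hVc] at hslope
    have hVr : 0 < V r := by
      have := (hslope 0 ⟨le_rfl, hr.le⟩ r ⟨hr.le, le_rfl⟩).1
      rw [hV0, sub_zero, sub_zero] at this
      exact (mul_pos (sub_pos.2 hεc) hr).trans_le this
    filter_upwards [hxp, Ioo_mem_nhdsGT hVr] with h ⟨hp, hVp, hfirst⟩ hh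
    obtain ⟨x, hx, hxh⟩ : h ∈ V '' Ioo 0 r :=
      intermediate_value_Ioo hr.le hcont (by rwa [hV0])
    have hpr : xp h ≤ r := by
      by_contra! hlt
      exact hfirst x ⟨hx.1, hx.2.trans hlt⟩ hxh
    have hbd : ∀ y ∈ Icc 0 (xp h), _ := fun y hy =>
      hslope y ⟨hy.1, hy.2.trans hpr⟩ (xp h) ⟨hy.2, hpr⟩
    rw [hVp] at hbd
    rw [hτ]
    exact transit_integral_bounds (sub_pos.2 hεc) (by positivity) hp hV0
      (hcont.mono fun y hy => ⟨hy.1.le, hy.2.trans hpr⟩)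
      (fun y hy => (hbd y hy).1) (fun y hy => (hbd y hy).2)
  refine ⟨(main (c / 2) (by positivity) (by linarith)).mono fun h hh => hh.1, ?_⟩
  have hε : ∀ᶠ ε in 𝓝[>] (0 : ℝ), ε ∈ Ioo 0 c := Ioo_mem_nhdsGT hc
  refine tendsto_order.2 ⟨fun l hl => ?_, fun u hu => ?_⟩
  · have ht : Tendsto (fun ε : ℝ => 2 / (c + ε)) (𝓝[>] 0) (𝓝 (2 / c)) := by
      have : ContinuousAt (fun ε : ℝ => 2 / (c + ε)) 0 :=
        continuousAt_const.div (by fun_prop) (by simpa using hc.ne')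
      simpa using this.tendsto.mono_left nhdsWithin_le_nhds
    obtain ⟨ε, hεl, hε⟩ := ((ht.eventually_const_lt hl).and hε).exists
    exact (main ε hε.1 hε.2).mono fun h hh => hεl.trans_le hh.2.1
  · have ht : Tendsto (fun ε : ℝ => 2 / (c - ε)) (𝓝[>] 0) (𝓝 (2 / c)) := by
      have : ContinuousAt (fun ε : ℝ => 2 / (c - ε)) 0 :=
        continuousAt_const.div (by fun_prop) (by simpa using hc.ne')
      simpa using this.tendsto.mono_left nhdsWithin_le_nhds
    obtain ⟨ε, hεu, hε⟩ := ((ht.eventually_lt_const hu).and hε).exists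
    exact (main ε hε.1 hε.2).mono fun h hh => hh.2.2.trans_lt hεu
end
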